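/- arXiv:2009.05869 — 4 statements merged into one kernel-verified Lean document; each statement's English description precedes it below -/
import Mathlib

section
/- For every integer k ≥ 2 and every integer L ≥ 20k, the random variables P_0(L) and P_1(L) satisfy E[P_1(L) − P_0(L)] ≥ √(L/(7k)). -/
/-- `u` is `d`-almost contained in `v`: one may remove at most `d` symbols from `u`
and obtain a subsequence of `v`. -/
def AlmostIn (d : ℕ) (u v : List ℕ) : Prop :=
  ∃ s : List ℕ, s.Sublist u ∧ u.length ≤ s.length + d ∧ s.Sublist v

/-- The length-`m` prefix of an infinite word `w : ℕ → ℕ`. -/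
def pre (w : ℕ → ℕ) (m : ℕ) : List ℕ :=
  (List.range m).map w

/-- `Pd d L w w'` is the random variable `P_d(L)`: the length of the longest prefix of the
infinite word `w` that is `d`-almost contained in the length-`L` prefix of `w'`. -/
noncomputable def Pd (d L : ℕ) (w w' : ℕ → ℕ) : ℕ :=
  sSup {m | AlmostIn d (pre w m) (pre w' L)}

/-- Expectation of `f(w, w')` for independent uniformly random infinite words `w, w'` over the
alphabet `[k] = {1, …, k}`, for a function `f` depending only on the first `N` symbols of `w`
and the first `N'` symbols of `w'` (positions beyond the cutoffs are padded with the symbol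
`1`, which such an `f` never reads). -/
noncomputable def EE (k N N' : ℕ) (f : (ℕ → ℕ) → (ℕ → ℕ) → ℝ) : ℝ :=
  (∑ u : Fin N → Fin k, ∑ v : Fin N' → Fin k,
      f (fun i => if h : i < N then (u ⟨i, h⟩ : ℕ) + 1 else 1)
        (fun i => if h : i < N' then (v ⟨i, h⟩ : ℕ) + 1 else 1)) /
    ((k : ℝ) ^ N * (k : ℝ) ^ N')

namespace AlmostContained

/-! ### Hitting times of the simple random walk -/

/-- The probability that a simple random walk started at `D` has not hit `0` after `i` steps. -/
noncomputable def surv (i D : ℕ) : ℝ :=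
  (∑ l ∈ Finset.range D, (i.choose ((i + l + 1) / 2) : ℝ)) / 2 ^ i

/-- The expected value of `min ν j`, where `ν` is the hitting time of `0` of a simple random walk
started at `D`. -/
noncomputable def hit (j D : ℕ) : ℝ := ∑ i ∈ Finset.range j, surv i D

lemma surv_nonneg (i D : ℕ) : 0 ≤ surv i D := by unfold surv; positivity

lemma surv_zero_right (i : ℕ) : surv i 0 = 0 := by simp [surv]

lemma surv_zero_left (d : ℕ) : surv 0 (d + 1) = 1 := by
  rw [surv, Finset.sum_range_succ']
  have : ∀ l ∈ Finset.range d, (Nat.choose 0 ((0 + (l + 1) + 1) / 2) : ℝ) = 0 := by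
    intro l _
    rw [Nat.choose_eq_zero_of_lt (by omega)]
    simp
  rw [Finset.sum_eq_zero this]
  simp

lemma choose_half_succ (i : ℕ) : i.choose (i / 2) = i.choose ((i + 1) / 2) := by
  apply Nat.choose_symm_of_eq_add
  omega

lemma surv_succ (i d : ℕ) :
    2 * surv (i + 1) (d + 1) = surv i (d + 2) + surv i d := by
  have key : (∑ l ∈ Finset.range (d + 1), ((i + 1).choose ((i + 1 + l + 1) / 2) : ℝ)) =
      (∑ l ∈ Finset.range (d + 2), (i.choose ((i + l + 1) / 2) : ℝ)) +
        ∑ l ∈ Finset.range d, (i.choose ((i + l + 1) / 2) : ℝ) := by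
    have h1 : ∀ l, ((i + 1).choose ((i + 1 + l + 1) / 2) : ℝ) =
        i.choose ((i + l) / 2) + i.choose ((i + (l + 1) + 1) / 2) := by
      intro l
      have e1 : (i + 1 + l + 1) / 2 = (i + l) / 2 + 1 := by omega
      have e2 : (i + (l + 1) + 1) / 2 = (i + l) / 2 + 1 := by omega
      rw [e1, e2, Nat.choose_succ_succ]
      push_cast; ring
    simp_rw [h1]
    rw [Finset.sum_add_distrib, Finset.sum_range_succ' (fun l => (i.choose ((i + l) / 2) : ℝ)),
      Finset.sum_range_succ' _ (d + 1)]
    simp only [add_zero]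
    rw [choose_half_succ]
    simp only [add_assoc]
    ring
  rw [surv, surv, surv, key, pow_succ]
  field_simp

lemma hit_nonneg (j D : ℕ) : 0 ≤ hit j D := Finset.sum_nonneg fun i _ => surv_nonneg i D

lemma hit_mono {i j : ℕ} (h : i ≤ j) (D : ℕ) : hit i D ≤ hit j D :=
  Finset.sum_le_sum_of_subset_of_nonneg (by simpa using h) fun i _ _ => surv_nonneg i D

lemma hit_zero_right (j : ℕ) : hit j 0 = 0 := by simp [hit, surv_zero_right]

lemma hit_zero_left (D : ℕ) : hit 0 D = 0 := by simp [hit]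

lemma hit_succ (j d : ℕ) :
    2 * hit (j + 1) (d + 1) = 2 + (hit j (d + 2) + hit j d) := by
  rw [hit, Finset.sum_range_succ', surv_zero_left, mul_add, Finset.mul_sum]
  simp_rw [surv_succ]
  rw [Finset.sum_add_distrib, hit, hit]
  ring

lemma one_le_hit (j d : ℕ) : 1 ≤ hit (j + 1) (d + 1) := by
  have := hit_succ j d
  have := hit_nonneg j (d + 2)
  have := hit_nonneg j d
  linarith

lemma hit_even (q : ℕ) : hit (2 * q) 1 = (4 * q + 1) * (q.centralBinom / 4 ^ q) - 1 := by
  induction q with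
  | zero => simp [hit]
  | succ q ih =>
    have e : 2 * (q + 1) = 2 * q + 1 + 1 := by ring
    have h0 : hit (2 * (q + 1)) 1 = hit (2 * q) 1 + surv (2 * q) 1 + surv (2 * q + 1) 1 := by
      rw [e, hit, Finset.sum_range_succ, Finset.sum_range_succ, ← hit]
    have h1 : surv (2 * q) 1 = q.centralBinom / 4 ^ q := by
      have : (2 * q + 1) / 2 = q := by omega
      simp [surv, this, Nat.centralBinom, pow_mul]
      norm_num
    have h2 : surv (2 * q + 1) 1 = (q + 1).centralBinom / 4 ^ (q + 1) := by
      have e1 : (2 * q + 1 + 1) / 2 = q + 1 := by omega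
      have e2 : ((q + 1).centralBinom : ℝ) = 2 * (2 * q + 1).choose (q + 1) := by
        rw [Nat.centralBinom, e, Nat.choose_succ_succ, ← Nat.choose_symm_half]
        push_cast; ring
      have e3 : (4 : ℝ) ^ (q + 1) = 2 * 2 ^ (2 * q + 1) := by
        rw [pow_succ 2, pow_mul, pow_succ]; norm_num; ring
      rw [e2, e3]
      simp [surv, e1]
      field_simp
    have h3 : ((q : ℝ) + 1) * (q + 1).centralBinom = 2 * (2 * q + 1) * q.centralBinom := by
      exact_mod_cast Nat.succ_mul_centralBinom_succ q
    rw [h0, h1, h2, ih, pow_succ]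
    push_cast
    field_simp
    linear_combination (-4) * h3

lemma sq_centralBinom_le (q : ℕ) : (3 * q + 1) * ((q.centralBinom : ℝ) / 4 ^ q) ^ 2 ≤ 1 := by
  induction q with
  | zero => simp
  | succ q ih =>
    have h3 : ((q : ℝ) + 1) * (q + 1).centralBinom = 2 * (2 * q + 1) * q.centralBinom := by
      exact_mod_cast Nat.succ_mul_centralBinom_succ q
    have h4 : ((q + 1).centralBinom : ℝ) / 4 ^ (q + 1) =
        (2 * q + 1) / (2 * (q + 1)) * (q.centralBinom / 4 ^ q) := by
      rw [pow_succ]; field_simp; linarith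
    rw [h4, mul_pow]
    refine le_trans ?_ ih
    rw [← mul_assoc]
    refine mul_le_mul_of_nonneg_right ?_ (sq_nonneg _)
    push_cast
    rw [div_pow, mul_div_assoc', div_le_iff₀ (by positivity)]
    have : (0 : ℝ) ≤ q := Nat.cast_nonneg q
    nlinarith

/-! ### Averages over words -/

/-- The average of `f` over the words of length `N` with letters in `{1, …, k}`. -/
noncomputable def avg (k : ℕ) : ℕ → (List ℕ → ℝ) → ℝ
  | 0, f => f []
  | N + 1, f => (∑ a ∈ Finset.Icc 1 k, avg k N fun l => f (a :: l)) / k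

lemma avg_succ (k N : ℕ) (f : List ℕ → ℝ) :
    avg k (N + 1) f = (∑ a ∈ Finset.Icc 1 k, avg k N fun l => f (a :: l)) / k := rfl

lemma avg_sum_div {k : ℕ} (N : ℕ) (s : Finset ℕ) (f : ℕ → List ℕ → ℝ) (x : ℝ) :
    avg k N (fun l => (∑ c ∈ s, f c l) / x) = (∑ c ∈ s, avg k N (f c)) / x := by
  induction N generalizing f with
  | zero => rfl
  | succ N ih =>
    simp only [avg_succ, ih]
    rw [← Finset.sum_div, ← Finset.sum_div, Finset.sum_comm, div_right_comm]

lemma avg_mono {k : ℕ} (N : ℕ) {f g : List ℕ → ℝ}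
    (h : ∀ l, l.length = N → f l ≤ g l) : avg k N f ≤ avg k N g := by
  induction N generalizing f g with
  | zero => exact h [] rfl
  | succ N ih =>
    simp only [avg_succ]
    gcongr with a ha
    exact ih fun l hl => h _ (by simp [hl])

lemma avg_congr {k : ℕ} (N : ℕ) {f g : List ℕ → ℝ}
    (h : ∀ l, l.length = N → f l = g l) : avg k N f = avg k N g :=
  le_antisymm (avg_mono N fun l hl => (h l hl).le) (avg_mono N fun l hl => (h l hl).ge)

lemma avg_append_singleton {k : ℕ} (hk : k ≠ 0) (N : ℕ) {f : List ℕ → ℝ}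
    (h : ∀ l a, l.length = N → f (l ++ [a]) = f l) : avg k (N + 1) f = avg k N f := by
  induction N generalizing f with
  | zero =>
    have h0 : ∀ a, f [a] = f [] := fun a => h [] a rfl
    have : (k : ℝ) ≠ 0 := by exact_mod_cast hk
    simp [avg, h0]
    field_simp
  | succ N ih =>
    rw [avg_succ, avg_succ]
    congr 1
    refine Finset.sum_congr rfl fun a _ => ih fun l b hl => ?_
    rw [← List.cons_append, h _ _ (by simp [hl])]

/-- The infinite word starting with `l`, padded with the letter `1`. -/
def toWord (l : List ℕ) (i : ℕ) : ℕ := l.getD i 1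

lemma sum_words_div {k : ℕ} (N : ℕ) (F : (ℕ → ℕ) → ℝ) :
    (∑ u : Fin N → Fin k, F fun i => if h : i < N then (u ⟨i, h⟩ : ℕ) + 1 else 1) / (k : ℝ) ^ N =
      avg k N fun l => F (toWord l) := by
  induction N generalizing F with
  | zero =>
    simp only [avg, Finset.univ_unique, Finset.sum_singleton, pow_zero, div_one]
    congr 1
  | succ N ih =>
    rw [avg_succ, ← (Fin.consEquiv fun _ => Fin k).sum_comp, Fintype.sum_prod_type]
    have hF : ∀ a, (fun l => F (toWord (a :: l))) =
        fun l => (fun w : ℕ → ℕ => F fun i => Nat.casesOn i a w) (toWord l) := by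
      intro a
      funext l
      congr 1
      funext i
      cases i <;> simp [toWord]
    have hS : ∀ g : ℕ → ℝ, ∑ a ∈ Finset.Icc 1 k, g a = ∑ a : Fin k, g (a + 1) := by
      intro g
      rw [Fin.sum_univ_eq_sum_range (fun i => g (i + 1)), Finset.range_eq_Ico,
        Finset.sum_Ico_add']
      rfl
    rw [hS, pow_succ, ← div_div, Finset.sum_div]
    congr 1
    refine Finset.sum_congr rfl fun a _ => ?_
    rw [hF, ← ih fun w : ℕ → ℕ => F fun i => Nat.casesOn i (a + 1) w]
    congr 1
    refine Finset.sum_congr rfl fun u _ => ?_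
    congr 1
    funext i
    cases i with
    | zero => simp [Fin.consEquiv]
    | succ i =>
      by_cases hi : i < N
      · simp only [hi, Nat.add_lt_add_iff_right, dite_true]
        rfl
      · simp [hi]

lemma EE_eq_avg (k N N' : ℕ) (f : (ℕ → ℕ) → (ℕ → ℕ) → ℝ) :
    EE k N N' f = avg k N fun u => avg k N' fun v => f (toWord u) (toWord v) := by
  rw [← sum_words_div N fun w => avg k N' fun v => f w (toWord v)]
  simp_rw [← sum_words_div N' (f _), EE]
  rw [← Finset.sum_div, div_div, mul_comm ((k : ℝ) ^ N')]

/-! ### The greedy walk -/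

/-- Update of a pair of pointers `(X, Y)` into the word `w` when the letter `c` is read: `X` is the
length of the longest prefix of `w` embedded greedily, and `Y` the length of the longest prefix of
`w` embedded with one deletion. -/
def step (w : ℕ → ℕ) (s : ℕ × ℕ) (c : ℕ) : ℕ × ℕ :=
  (if w s.1 = c then s.1 + 1 else s.1,
    max (if w s.2 = c then s.2 + 1 else s.2) ((if w s.1 = c then s.1 + 1 else s.1) + 1))

lemma step_congr {w w' : ℕ → ℕ} {s : ℕ × ℕ} {n : ℕ} (hX : s.1 < n) (hY : s.2 < n)
    (h : ∀ i < n, w i = w' i) (c : ℕ) : step w s c = step w' s c := by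
  simp only [step, h _ hX, h _ hY]

lemma step_snd_le (w : ℕ → ℕ) {s : ℕ × ℕ} (hs : s.1 < s.2) (c : ℕ) :
    (step w s c).1 < (step w s c).2 ∧ (step w s c).2 ≤ s.2 + 1 := by
  simp only [step]
  split_ifs <;> omega

lemma foldl_step_congr {w w' : ℕ → ℕ} (v : List ℕ) {s : ℕ × ℕ} (hs : s.1 < s.2)
    (h : ∀ i < s.2 + v.length, w i = w' i) : v.foldl (step w) s = v.foldl (step w') s := by
  induction v generalizing s with
  | nil => rfl
  | cons c v ih =>
    simp only [List.length_cons] at h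
    rw [List.foldl_cons, List.foldl_cons,
      ← step_congr (n := s.2 + 1) (by omega) (by omega) fun i hi => h i (by omega)]
    have := step_snd_le w hs c
    exact ih this.1 fun i hi => h i (by omega)

lemma pre_succ (w : ℕ → ℕ) (m : ℕ) : pre w (m + 1) = pre w m ++ [w m] := by
  simp [pre, List.range_succ]

lemma append_singleton_sublist {l l' : List ℕ} {a b : ℕ} :
    (l ++ [a]).Sublist (l' ++ [b]) ↔ (l ++ [a]).Sublist l' ∨ a = b ∧ l.Sublist l' := by
  rw [← List.reverse_sublist, List.reverse_append, List.reverse_append]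
  simp only [List.reverse_singleton, List.singleton_append, List.cons_sublist_cons']
  rw [← List.reverse_sublist (l₁ := l ++ [a]), ← List.reverse_sublist (l₁ := l)]
  simp

lemma foldl_step_spec (w : ℕ → ℕ) (v : List ℕ) :
    (∀ m, (pre w m).Sublist v ↔ m ≤ (v.foldl (step w) (0, 1)).1) ∧
      AlmostIn 1 (pre w (v.foldl (step w) (0, 1)).2) v := by
  induction v using List.reverseRecOn with
  | nil =>
    refine ⟨fun m => ?_, [], by simp, by simp [pre], by simp⟩
    simp [pre]
  | append_singleton v c ih =>
    rw [List.foldl_append, List.foldl_cons, List.foldl_nil]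
    obtain ⟨hX, t, ht, hlen, htv⟩ := ih
    generalize v.foldl (step w) (0, 1) = s at *
    have key : ∀ m, (pre w m).Sublist (v ++ [c]) ↔ m ≤ (step w s c).1 := by
      intro m
      cases m with
      | zero => simp [pre]
      | succ m =>
        rw [pre_succ, append_singleton_sublist, ← pre_succ, hX, hX]
        simp only [step]
        split_ifs with h
        · constructor
          · omega
          · intro hm
            rcases Nat.lt_or_ge m s.1 with h' | h'
            · exact Or.inl h'
            · obtain rfl : m = s.1 := by omega
              exact Or.inr ⟨h, le_rfl⟩
        · constructor
          · rintro (h' | ⟨h', h''⟩)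
            · exact h'
            · rcases h''.lt_or_eq with h1 | h1
              · exact h1
              · exact absurd (h1 ▸ h') h
          · exact Or.inl
    refine ⟨key, ?_⟩
    have hY : (step w s c).2 = max (if w s.2 = c then s.2 + 1 else s.2) ((step w s c).1 + 1) := rfl
    rcases max_choice (if w s.2 = c then s.2 + 1 else s.2) ((step w s c).1 + 1) with h | h
    · rw [hY, h]
      split_ifs with hc
      · refine ⟨t ++ [c], ?_, ?_, htv.append_right _⟩
        · rw [pre_succ, hc]
          exact ht.append_right _
        · rw [pre_succ]
          simp only [List.length_append, List.length_singleton]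
          omega
      · exact ⟨t, ht, hlen, htv.trans (List.sublist_append_left _ _)⟩
    · rw [hY, h]
      refine ⟨pre w (step w s c).1, ?_, ?_, (key _).2 le_rfl⟩
      · rw [pre_succ]
        exact List.sublist_append_left _ _
      · simp [pre]

/-- The final difference of the pointers, starting from `s`, when the letters of `v` are read. -/
def gap (w : ℕ → ℕ) (s : ℕ × ℕ) (v : List ℕ) : ℝ :=
  ((v.foldl (step w) s).2 : ℝ) - (v.foldl (step w) s).1

lemma pre_toWord (v : List ℕ) : pre (toWord v) v.length = v := by
  apply List.ext_getElem
  · simp [pre]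
  · intro i h1 h2
    simp [pre, toWord, h2]

lemma gap_le_Pd (w : ℕ → ℕ) (v : List ℕ) :
    gap w (0, 1) v ≤ (Pd 1 v.length w (toWord v) : ℝ) - Pd 0 v.length w (toWord v) := by
  obtain ⟨hX, hY⟩ := foldl_step_spec w v
  have h0 : Pd 0 v.length w (toWord v) ≤ (v.foldl (step w) (0, 1)).1 := by
    refine csSup_le' ?_
    rintro m ⟨t, ht, hlen, htv⟩
    rw [pre_toWord] at htv
    rw [← hX, ← ht.eq_of_length_le hlen]
    exact htv
  have h1 : (v.foldl (step w) (0, 1)).2 ≤ Pd 1 v.length w (toWord v) := by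
    refine le_csSup ⟨v.length + 1, ?_⟩ ?_
    · rintro m ⟨t, ht, hlen, htv⟩
      rw [pre_toWord] at htv
      have := htv.length_le
      simp only [pre, List.length_map, List.length_range] at hlen
      omega
    · simpa only [Set.mem_ofPred_eq, pre_toWord] using hY
  unfold gap
  have h0' : (Pd 0 v.length w (toWord v) : ℝ) ≤ (v.foldl (step w) (0, 1)).1 := by exact_mod_cast h0
  have h1' : ((v.foldl (step w) (0, 1)).2 : ℝ) ≤ Pd 1 v.length w (toWord v) := by exact_mod_cast h1
  linarith

/-! ### A lower bound for the expected gap -/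

/-- The average of the gap after `s` letters are read, starting from the pointers `p` in the word
starting with `l`, over the next `N` letters of that word. -/
noncomputable def avgGap (k s N : ℕ) (l : List ℕ) (p : ℕ × ℕ) : ℝ :=
  avg k N fun r => avg k s fun v => gap (toWord (l ++ r)) p v

lemma avgGap_succ_left {k : ℕ} (s N : ℕ) {l : List ℕ} {p : ℕ × ℕ} (h1 : p.1 < l.length)
    (h2 : p.2 < l.length) :
    avgGap k (s + 1) N l p =
      (∑ c ∈ Finset.Icc 1 k, avgGap k s N l (step (toWord l) p c)) / k := by
  simp only [avgGap]
  rw [← avg_sum_div]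
  refine avg_congr N fun r _ => ?_
  rw [avg_succ]
  congr 1
  refine Finset.sum_congr rfl fun c _ => avg_congr s fun v _ => ?_
  rw [gap, List.foldl_cons, step_congr h1 h2 fun i hi => ?_, ← gap]
  rw [toWord, toWord, List.getD_append _ _ _ _ hi]

lemma avgGap_succ_right (k s N : ℕ) (l : List ℕ) (p : ℕ × ℕ) :
    avgGap k s (N + 1) l p = (∑ a ∈ Finset.Icc 1 k, avgGap k s N (l ++ [a]) p) / k := by
  simp only [avgGap, avg_succ, List.append_assoc, List.singleton_append]

lemma avg_const {k : ℕ} (hk : k ≠ 0) (N : ℕ) (x : ℝ) : avg k N (fun _ => x) = x := by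
  have : (k : ℝ) ≠ 0 := by exact_mod_cast hk
  induction N with
  | zero => rfl
  | succ N ih =>
    simp only [avg_succ, ih, Finset.sum_const, Nat.card_Icc, add_tsub_cancel_right, nsmul_eq_mul]
    field_simp

lemma le_sum_of_ne {k x : ℕ} (hx : x ∈ Finset.Icc 1 k) {g : ℕ → ℝ} {A C : ℝ} (hA : A ≤ g x)
    (hC : ∀ c ∈ Finset.Icc 1 k, c ≠ x → C ≤ g c) :
    A + (k - 1) * C ≤ ∑ c ∈ Finset.Icc 1 k, g c := by
  have h : ∑ c ∈ Finset.Icc 1 k, (C + if c = x then A - C else 0) ≤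
      ∑ c ∈ Finset.Icc 1 k, g c := by
    refine Finset.sum_le_sum fun c hc => ?_
    split_ifs with h
    · subst h; linarith
    · linarith [hC c hc h]
  refine le_trans (le_of_eq ?_) h
  rw [Finset.sum_add_distrib, Finset.sum_ite_eq' _ x, if_pos hx]
  simp
  ring

lemma le_sum_of_ne_of_ne {k x y : ℕ} (hx : x ∈ Finset.Icc 1 k) (hy : y ∈ Finset.Icc 1 k)
    (hxy : x ≠ y) {g : ℕ → ℝ} {A B C : ℝ} (hA : A ≤ g x) (hB : B ≤ g y)
    (hC : ∀ c ∈ Finset.Icc 1 k, c ≠ x → c ≠ y → C ≤ g c) :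
    A + B + (k - 2) * C ≤ ∑ c ∈ Finset.Icc 1 k, g c := by
  have h : ∑ c ∈ Finset.Icc 1 k,
      (C + (if c = x then A - C else 0) + if c = y then B - C else 0) ≤
      ∑ c ∈ Finset.Icc 1 k, g c := by
    refine Finset.sum_le_sum fun c hc => ?_
    split_ifs with h h' h'
    · exact absurd (h.symm.trans h') hxy
    · subst h; linarith
    · subst h'; linarith
    · linarith [hC c hc h h']
  refine le_trans (le_of_eq ?_) h
  rw [Finset.sum_add_distrib, Finset.sum_add_distrib, Finset.sum_ite_eq' _ x,
    Finset.sum_ite_eq' _ y, if_pos hx, if_pos hy]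
  simp
  ring

/-- For a simple random walk reflected at `1` and standing at `D`, the price `h * D` of its position
minus the shortfall of the expected length of the current excursion within `j` steps. -/
noncomputable def potential (h : ℝ) (j D : ℕ) : ℝ := h * D - hit j D + j

lemma two_mul_potential_le {h : ℝ} {j : ℕ} (hh : hit j 1 ≤ h) (d : ℕ) :
    2 * potential h j (d + 1) ≤ potential h (j - 1) (d + 2) + potential h (j - 1) (max d 1) := by
  have h0 : 0 ≤ h := (hit_nonneg _ _).trans hh
  cases j with
  | zero =>
    have hd : (d : ℝ) ≤ (max d 1 : ℕ) := Nat.cast_le.2 (le_max_left d 1)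
    have := mul_le_mul_of_nonneg_left hd h0
    simp only [potential, hit_zero_left, Nat.zero_sub, Nat.cast_zero]
    push_cast at *
    linarith
  | succ j =>
    have h1 := hit_succ j d
    rcases Nat.eq_zero_or_pos d with rfl | hd
    · rw [hit_zero_right] at h1
      have := hit_mono (Nat.le_succ j) 1
      simp only [potential, Nat.add_sub_cancel, Nat.zero_le, max_eq_right]
      push_cast
      simp only [Nat.succ_eq_add_one, zero_add] at *
      linarith
    · rw [max_eq_left (show 1 ≤ d from hd)]
      simp only [potential, Nat.add_sub_cancel]
      push_cast
      linarith

lemma potential_sub_le_avgGap {k : ℕ} (hk : 2 ≤ k) {t h : ℝ} (ht0 : 0 ≤ t) (ht1 : t ≤ 1) {m : ℕ}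
    (hh : hit m 1 ≤ h) (s N : ℕ) (l : List ℕ) (X d j : ℕ) (κ : ℝ) (hs : s ≤ N)
    (hl : ∀ z ∈ l, z ∈ Finset.Icc 1 k) (hlen : l.length = X + d + 2) (hj : j ≤ m) (hκ : 0 ≤ κ)
    (hκj : ∀ i : ℕ, (j : ℝ) - i ≤ κ * t ^ i) :
    potential h j (d + 1) - κ * (if toWord l X = toWord l (X + d + 1) then 1 else t) *
        (1 - (1 - 1 / k) * (1 - t) / k) ^ s ≤
      h * avgGap k s N l (X, X + d + 1) := by
  have hk0 : (2 : ℝ) ≤ k := by exact_mod_cast hk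
  have hkinv : (1 : ℝ) / k ≤ 1 := by rw [div_le_one (by linarith)]; linarith
  have hkinv0 : (0 : ℝ) ≤ 1 / k := by positivity
  have hρ0 : 0 ≤ 1 - (1 - 1 / (k : ℝ)) * (1 - t) / k := by
    have : (1 - 1 / (k : ℝ)) * (1 - t) ≤ 1 := mul_le_one₀ (by linarith) (by linarith) (by linarith)
    rw [sub_nonneg, div_le_one (by linarith)]
    linarith
  have hmem : ∀ l : List ℕ, (∀ z ∈ l, z ∈ Finset.Icc 1 k) → ∀ i < l.length,
      toWord l i ∈ Finset.Icc 1 k := by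
    intro l hl i hi
    rw [toWord, List.getD_eq_getElem _ _ hi]
    exact hl _ (List.getElem_mem hi)
  have hh0 : 0 ≤ h := (hit_nonneg _ _).trans hh
  induction s generalizing N l X d j κ with
  | zero =>
    have e : avgGap k 0 N l (X, X + d + 1) = (d + 1 : ℕ) := by
      rw [avgGap, ← avg_const (by omega : k ≠ 0) N ((d + 1 : ℕ) : ℝ)]
      refine avg_congr N fun r _ => ?_
      simp only [avg, gap, List.foldl_nil]
      push_cast; ring
    rw [e, potential, pow_zero, mul_one]
    have h1 := hκj 0
    have h2 := hκj 1
    simp only [pow_zero, Nat.cast_zero, pow_one, Nat.cast_one] at h1 h2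
    have h3 := hit_nonneg j (d + 1)
    split_ifs
    · linarith
    · cases j with
      | zero =>
        have := mul_nonneg hκ ht0
        simp only [Nat.cast_zero]
        linarith
      | succ j => linarith [one_le_hit j d]
  | succ s ih =>
    set ρ := 1 - (1 - 1 / (k : ℝ)) * (1 - t) / k with hρ
    obtain ⟨N, rfl⟩ : ∃ N', N = N' + 1 := ⟨N - 1, by omega⟩
    have fresh : ∀ (X d j : ℕ) (κ : ℝ), l.length = X + d + 1 → j ≤ m → 0 ≤ κ →
        (∀ i : ℕ, (j : ℝ) - i ≤ κ * t ^ i) →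
        potential h j (d + 1) - κ * (1 - (1 - 1 / (k : ℝ)) * (1 - t)) * ρ ^ s ≤
          h * avgGap k s (N + 1) l (X, X + d + 1) := by
      intro X d j κ hlen hj hκ hκj
      rw [avgGap_succ_right, ← mul_div_assoc, Finset.mul_sum, le_div_iff₀ (by linarith)]
      have hext : ∀ a, toWord (l ++ [a]) X = toWord l X := fun a => by
        have hX : X < l.length := by omega
        rw [toWord, toWord, List.getD_append _ _ _ _ hX]
      have hlast : ∀ a, toWord (l ++ [a]) (X + d + 1) = a := fun a => by
        simp [toWord, ← hlen]
      have hb : ∀ a ∈ Finset.Icc 1 k, potential h j (d + 1) -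
          κ * (if toWord l X = a then 1 else t) * ρ ^ s ≤
          h * avgGap k s N (l ++ [a]) (X, X + d + 1) := by
        intro a ha
        have := ih N (l ++ [a]) X d j κ (by omega)
          (fun z hz => (List.mem_append.1 hz).elim (hl z)
            fun hz => List.mem_singleton.1 hz ▸ ha) (by simp [hlen]) hj hκ hκj
        rwa [hext, hlast] at this
      have hx : toWord l X ∈ Finset.Icc 1 k := hmem l hl X (by omega)
      refine le_trans (le_of_eq ?_) (le_sum_of_ne hx (hb _ hx)
        (C := potential h j (d + 1) - κ * t * ρ ^ s) fun c hc hne => ?_)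
      · rw [if_pos rfl]
        field_simp
        ring
      · have := hb c hc
        rwa [if_neg (Ne.symm hne)] at this
    have hx : toWord l X ∈ Finset.Icc 1 k := hmem l hl X (by omega)
    have hy : toWord l (X + d + 1) ∈ Finset.Icc 1 k := hmem l hl _ (by omega)
    have stay := ih (N + 1) l X d j κ (by omega) hl hlen hj hκ hκj
    rw [avgGap_succ_left s (N + 1) (by simp; omega) (by simp; omega), ← mul_div_assoc,
      Finset.mul_sum, le_div_iff₀ (by linarith)]
    have hκP : 0 ≤ κ * ρ ^ s := mul_nonneg hκ (pow_nonneg hρ0 s)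
    by_cases hxy : toWord l X = toWord l (X + d + 1)
    · rw [if_pos hxy] at stay ⊢
      have hstep : step (toWord l) (X, X + d + 1) (toWord l X) = (X + 1, X + 1 + d + 1) := by
        simp only [step, if_true, ← hxy]
        congr 1
        omega
      have both := fresh (X + 1) d j κ (by omega) hj hκ hκj
      rw [← hstep] at both
      refine le_trans (le_of_eq ?_) (le_sum_of_ne hx both (C := potential h j (d + 1) - κ * 1 * ρ ^ s)
        fun c hc hne => ?_)
      · rw [pow_succ, hρ]
        field_simp
        ring
      · have hstep' : step (toWord l) (X, X + d + 1) c = (X, X + d + 1) := by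
          simp only [step, ← hxy, if_neg (Ne.symm hne)]
          congr 1
          omega
        rwa [hstep']
    · rw [if_neg hxy] at stay ⊢
      have hφ1 : 1 - (1 - 1 / (k : ℝ)) * (1 - t) ≤ 1 := by
        have : 0 ≤ (1 - 1 / (k : ℝ)) * (1 - t) := mul_nonneg (by linarith) (by linarith)
        linarith
      have hj' : j - 1 ≤ m := by omega
      have hκ' : 0 ≤ κ * t := mul_nonneg hκ ht0
      have hκP' : 0 ≤ κ * t * ρ ^ s := mul_nonneg hκ' (pow_nonneg hρ0 s)
      have hκj' : ∀ i : ℕ, ((j - 1 : ℕ) : ℝ) - i ≤ κ * t * t ^ i := by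
        intro i
        cases j with
        | zero =>
          have : 0 ≤ κ * t * t ^ i := mul_nonneg hκ' (pow_nonneg ht0 i)
          have : (0 : ℝ) ≤ i := Nat.cast_nonneg i
          simp only [Nat.zero_sub, Nat.cast_zero]
          linarith
        | succ j =>
          have := hκj (i + 1)
          rw [pow_succ'] at this
          push_cast at this
          simp only [Nat.add_sub_cancel]
          linarith
      have hYstep : step (toWord l) (X, X + d + 1) (toWord l (X + d + 1)) =
          (X, X + (d + 1) + 1) := by
        simp only [step, if_true, if_neg hxy]
        congr 1
        omega
      have up := fresh X (d + 1) (j - 1) (κ * t) (by omega) hj' hκ' hκj'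
      rw [← hYstep] at up
      have down : potential h (j - 1) (max d 1) - κ * t * ρ ^ s ≤
          h * avgGap k s (N + 1) l (step (toWord l) (X, X + d + 1) (toWord l X)) := by
        have hXstep : step (toWord l) (X, X + d + 1) (toWord l X) =
            (X + 1, max (X + d + 1) (X + 2)) := by
          simp only [step, if_true, if_neg (Ne.symm hxy)]
        rw [hXstep]
        cases d with
        | zero =>
          have := fresh (X + 1) 0 (j - 1) (κ * t) (by omega) hj' hκ' hκj'
          have h2 := mul_le_mul_of_nonneg_left hφ1 hκP'
          rw [show max (X + 0 + 1) (X + 2) = X + 1 + 0 + 1 by omega]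
          simp only [Nat.zero_le, max_eq_right, zero_add] at *
          linarith
        | succ d =>
          have := ih (N + 1) l (X + 1) d (j - 1) (κ * t) (by omega) hl (by omega) hj' hκ' hκj'
          rw [show max (X + (d + 1) + 1) (X + 2) = X + 1 + d + 1 by omega,
            show max (d + 1) 1 = d + 1 by omega]
          refine le_trans ?_ this
          split_ifs
          · linarith
          · have := mul_le_mul_of_nonneg_left ht1 hκP'
            linarith
      have hpot := two_mul_potential_le ((hit_mono hj 1).trans hh) d
      refine le_trans ?_ (le_sum_of_ne_of_ne hx hy hxy down up
        (C := potential h j (d + 1) - κ * t * ρ ^ s) fun c hc hne hne' => ?_)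
      · have e : (1 - (1 - 1 / (k : ℝ)) * (1 - t)) = k * ρ - k + 1 := by
          rw [hρ]
          field_simp
          ring
        rw [e, pow_succ]
        linarith
      · have hstep' : step (toWord l) (X, X + d + 1) c = (X, X + d + 1) := by
          simp only [step, if_neg (Ne.symm hne), if_neg (Ne.symm hne')]
          congr 1
          omega
        rwa [hstep']

lemma sub_le_hit_mul_EE {k : ℕ} (hk : 2 ≤ k) (L m : ℕ) {t κ : ℝ} (ht0 : 0 ≤ t) (ht1 : t ≤ 1)
    (hκ : 0 ≤ κ) (hκm : ∀ i : ℕ, (m : ℝ) - i ≤ κ * t ^ i) :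
    m - κ * (1 - (1 - 1 / k) * (1 - t) / k) ^ L ≤
      hit m 1 * EE k (L + 1) L (fun w w' => (Pd 1 L w w' : ℝ) - (Pd 0 L w w' : ℝ)) := by
  have hk0 : (2 : ℝ) ≤ k := by exact_mod_cast hk
  have hρ0 : 0 ≤ 1 - (1 - 1 / (k : ℝ)) * (1 - t) / k := by
    have h1 : (1 : ℝ) / k ≤ 1 := by rw [div_le_one (by linarith)]; linarith
    have h2 : (0 : ℝ) ≤ 1 / k := by positivity
    have : (1 - 1 / (k : ℝ)) * (1 - t) ≤ 1 := mul_le_one₀ (by linarith) (by linarith) (by linarith)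
    rw [sub_nonneg, div_le_one (by linarith)]
    linarith
  have h1 : avgGap k L (L + 1) [] (0, 1) ≤
      EE k (L + 1) L (fun w w' => (Pd 1 L w w' : ℝ) - (Pd 0 L w w' : ℝ)) := by
    rw [EE_eq_avg]
    refine avg_mono _ fun u _ => avg_mono _ fun v hv => ?_
    simpa [hv] using gap_le_Pd (toWord u) v
  have h2 : avgGap k L (L + 2) [] (0, 1) = avgGap k L (L + 1) [] (0, 1) := by
    refine avg_append_singleton (by omega) _ fun l a hl => avg_congr _ fun v hv => ?_
    rw [gap, foldl_step_congr v (by simp) fun i hi => ?_, ← gap]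
    rw [List.nil_append, List.nil_append, toWord, toWord, List.getD_append]
    dsimp only at hi
    omega
  refine le_trans ?_ (mul_le_mul_of_nonneg_left h1 (hit_nonneg m 1))
  rw [← h2, avgGap_succ_right]
  simp only [avgGap_succ_right, List.nil_append, List.singleton_append]
  rw [← Finset.sum_div, div_div, mul_div_assoc', Finset.mul_sum, le_div_iff₀ (by positivity)]
  simp only [Finset.mul_sum]
  have key : ∀ a ∈ Finset.Icc 1 k, ∀ b ∈ Finset.Icc 1 k,
      m - κ * (1 - (1 - 1 / k) * (1 - t) / k) ^ L ≤ hit m 1 * avgGap k L L [a, b] (0, 1) := by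
    intro a ha b hb
    have := potential_sub_le_avgGap hk ht0 ht1 le_rfl L L [a, b] 0 0 m κ le_rfl
      (by simpa using ⟨by simpa using ha, by simpa using hb⟩) rfl le_rfl hκ hκm
    refine le_trans ?_ this
    have hP := mul_nonneg hκ (pow_nonneg hρ0 L)
    have hP' := mul_le_mul_of_nonneg_left ht1 hP
    simp only [potential, zero_add, Nat.cast_one, mul_one, sub_self]
    split_ifs <;> linarith
  calc _ = ∑ a ∈ Finset.Icc 1 k, ∑ b ∈ Finset.Icc 1 k,
        (m - κ * (1 - (1 - 1 / (k : ℝ)) * (1 - t) / k) ^ L) := by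
        simp only [Finset.sum_const, Nat.card_Icc, add_tsub_cancel_right, nsmul_eq_mul]
        ring
    _ ≤ _ := Finset.sum_le_sum fun a ha => Finset.sum_le_sum fun b hb => key a ha b hb

lemma sub_sq_half_le {x : ℝ} (hx : 0 ≤ x) : x - x ^ 2 / 2 ≤ 1 - Real.exp (-x) := by
  have h1 := Real.quadratic_le_exp_of_nonneg hx
  have h2 : Real.exp (-x) * Real.exp x = 1 := by rw [← Real.exp_add]; simp
  have h3 := Real.exp_pos (-x)
  have h4 : Real.exp (-x) * (1 + x + x ^ 2 / 2) ≤ 1 :=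
    (mul_le_mul_of_nonneg_left h1 h3.le).trans h2.le
  have h5 : 1 ≤ (1 - x + x ^ 2 / 2) * (1 + x + x ^ 2 / 2) := by nlinarith [sq_nonneg (x ^ 2)]
  have h6 : 0 < 1 + x + x ^ 2 / 2 := by positivity
  have h7 := le_of_mul_le_mul_right (h4.trans h5) h6
  linarith

lemma exp_neg_half_le : Real.exp (-(1 / 2)) ≤ 0.607 := by
  have h1 : Real.exp (-(1 / 2)) ^ 2 * Real.exp 1 = 1 := by
    rw [← Real.exp_nat_mul, ← Real.exp_add]; norm_num
  have h2 := Real.exp_one_gt_d9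
  refine (abs_le_of_sq_le_sq' ?_ (by norm_num)).2
  nlinarith [sq_nonneg (Real.exp (-(1 / 2)))]

/-- With `m = 2 q ≤ L / (2 k)`, the Laplace transform bound loses at most `0.607 √m`. -/
lemma sub_sqrt_le_hit_mul_EE {k L m : ℕ} (hk : 2 ≤ k) (hm : 0 < m) (hL : 2 * k * m ≤ L) :
    m - 0.607 * √m ≤
      hit m 1 * EE k (L + 1) L (fun w w' => (Pd 1 L w w' : ℝ) - (Pd 0 L w w' : ℝ)) := by
  have hk0 : (2 : ℝ) ≤ k := by exact_mod_cast hk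
  have hm0 : (0 : ℝ) < m := by exact_mod_cast hm
  have hL0 : 2 * (k : ℝ) * m ≤ L := by exact_mod_cast hL
  set r := √(m : ℝ) with hr
  have hr0 : 0 < r := Real.sqrt_pos.2 hm0
  have hrr : r * r = m := Real.mul_self_sqrt hm0.le
  set t := Real.exp (-(1 / r)) with ht
  have ht1 : t ≤ 1 := Real.exp_le_one_iff.2 (by simp [hr0.le])
  have hκ0 : 0 ≤ r * Real.exp (r - 1) := by positivity
  refine le_trans ?_ (sub_le_hit_mul_EE hk L m (Real.exp_nonneg _) ht1 hκ0 fun i => ?_)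
  · have hx : (1 / r - (1 / r) ^ 2 / 2) / (2 * k) ≤ (1 - 1 / k) * (1 - t) / k := by
      have h1 := sub_sq_half_le (x := 1 / r) (by positivity)
      have h2 : (1 : ℝ) / 2 ≤ 1 - 1 / k := by
        have : (1 : ℝ) / k ≤ 1 / 2 := one_div_le_one_div_of_le (by norm_num) hk0
        linarith
      rw [← div_div]
      gcongr
      nlinarith
    have hnn : 0 ≤ (1 / r - (1 / r) ^ 2 / 2) / (2 * k) := by
      have : 1 ≤ r := by rw [hr, Real.one_le_sqrt]; exact_mod_cast hm
      have h1 : 1 / r ≤ 1 := by rw [div_le_one hr0]; exact this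
      have h2 : 0 < 1 / r := by positivity
      have : 0 ≤ 1 / r - (1 / r) ^ 2 / 2 := by nlinarith
      positivity
    have hle1 : (1 - 1 / (k : ℝ)) * (1 - t) / k ≤ 1 := by
      have h1 : (1 : ℝ) / k ≤ 1 := by rw [div_le_one (by linarith)]; linarith
      have h2 : (0 : ℝ) ≤ 1 / k := by positivity
      have h3 : 0 ≤ t := Real.exp_nonneg _
      have : (1 - 1 / (k : ℝ)) * (1 - t) ≤ 1 :=
        mul_le_one₀ (by linarith) (by linarith) (by linarith)
      rw [div_le_one (by linarith)]
      linarith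
    have hpow : (1 - (1 - 1 / (k : ℝ)) * (1 - t) / k) ^ L ≤ Real.exp (-(r - 1 / 2)) := by
      calc _ ≤ Real.exp (-((1 / r - (1 / r) ^ 2 / 2) / (2 * k))) ^ L := by
            refine pow_le_pow_left₀ (by linarith) ?_ L
            refine le_trans ?_ (Real.add_one_le_exp _)
            linarith
        _ = Real.exp (-(L * ((1 / r - (1 / r) ^ 2 / 2) / (2 * k)))) := by
            rw [← Real.exp_nat_mul]; congr 1; ring
        _ ≤ _ := by
            rw [Real.exp_le_exp, neg_le_neg_iff]
            refine le_trans (le_of_eq ?_) (mul_le_mul_of_nonneg_right hL0 hnn)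
            rw [← hrr]
            field_simp
    have : r * Real.exp (r - 1) * (1 - (1 - 1 / (k : ℝ)) * (1 - t) / k) ^ L ≤ 0.607 * r := by
      calc _ ≤ r * Real.exp (r - 1) * Real.exp (-(r - 1 / 2)) := by gcongr
        _ = Real.exp (-(1 / 2)) * r := by
            rw [mul_assoc, ← Real.exp_add, mul_comm]; congr 2; ring
        _ ≤ _ := mul_le_mul_of_nonneg_right exp_neg_half_le hr0.le
    linarith
  · have h1 := Real.add_one_le_exp (r - i / r - 1)
    have h2 : Real.exp (r - 1) * t ^ i = Real.exp (r - i / r - 1) := by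
      rw [ht, ← Real.exp_nat_mul, ← Real.exp_add]; congr 1; ring
    rw [mul_assoc, h2]
    calc (m : ℝ) - i = r * (r - i / r) := by field_simp; linarith
      _ ≤ _ := by gcongr; linarith

lemma sqrt_mul_hit_le {q : ℕ} (hq : 5 ≤ q) :
    √((4 * q + 4) / 7) * hit (2 * q) 1 ≤ (2 * q : ℕ) - 0.607 * √(2 * q : ℕ) := by
  have hq0 : (5 : ℝ) ≤ q := by exact_mod_cast hq
  rw [hit_even]
  set c : ℝ := q.centralBinom / 4 ^ q with hc
  have hc0 : 0 ≤ c := by positivity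
  have hc1 : (3 * q + 1) * c ^ 2 ≤ 1 := sq_centralBinom_le q
  set w := √(q : ℝ) with hw
  have hww : w ^ 2 = q := Real.sq_sqrt (by linarith)
  have hw0 : 2.236 ≤ w := Real.le_sqrt_of_sq_le (by norm_num; linarith)
  set R := √((4 * (q : ℝ) + 4) / 7) with hR
  have hRR : R ^ 2 = (4 * q + 4) / 7 := Real.sq_sqrt (by positivity)
  have hR0 : 0 ≤ R := Real.sqrt_nonneg _
  have hRw : 0.7559 * w ≤ R := by
    refine (abs_le_of_sq_le_sq' ?_ hR0).2
    rw [mul_pow, hww, hRR]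
    norm_num
    linarith
  have h2 : √((2 * q : ℕ) : ℝ) ≤ 1.41422 * w := by
    refine Real.sqrt_le_iff.2 ⟨by linarith, ?_⟩
    rw [mul_pow, hww]
    push_cast
    norm_num
    linarith
  have hRc : R * c ≤ 0.463 := by
    refine (abs_le_of_sq_le_sq' ?_ (by norm_num)).2
    rw [mul_pow, hRR]
    have : (4 * (q : ℝ) + 4) / 7 ≤ 0.463 ^ 2 * (3 * q + 1) := by norm_num; linarith
    calc _ ≤ 0.463 ^ 2 * (3 * q + 1) * c ^ 2 := by gcongr
      _ = 0.463 ^ 2 * ((3 * q + 1) * c ^ 2) := by ring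
      _ ≤ _ := by nlinarith
  have h3 : R * c * (4 * q + 1) ≤ 0.463 * (4 * q + 1) := by gcongr
  push_cast at *
  nlinarith

end AlmostContained

/-- For every integer `k ≥ 2` and every integer `L ≥ 20k`,
`E[P_1(L) − P_0(L)] ≥ √(L/(7k))`.  (Since `P_1(L) ≤ L + 1` always, the random variable
`P_1(L) − P_0(L)` depends only on the first `L+1` symbols of `w` and the first `L`
symbols of `w'`, so its expectation is computed by `EE k (L+1) L`.) -/
theorem stmt2 (k L : ℕ) (hk : 2 ≤ k) (hL : 20 * k ≤ L) :
    Real.sqrt ((L : ℝ) / (7 * k)) ≤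
      EE k (L + 1) L (fun w w' => (Pd 1 L w w' : ℝ) - (Pd 0 L w w' : ℝ)) := by
  have hq : 5 ≤ L / (4 * k) := by
    rw [Nat.le_div_iff_mul_le (by omega)]
    omega
  set q := L / (4 * k) with hqd
  have hk0 : (0 : ℝ) < k := by exact_mod_cast (by omega : 0 < k)
  have hle : 2 * k * (2 * q) ≤ L := by
    have := Nat.mul_div_le L (4 * k)
    calc 2 * k * (2 * q) = 4 * k * q := by ring
      _ ≤ L := this
  have hlt : L ≤ 4 * k * (q + 1) := (Nat.lt_mul_div_succ L (by omega)).le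
  have hlt' : (L : ℝ) ≤ 4 * k * (q + 1) := by exact_mod_cast hlt
  have hsqrt : √((L : ℝ) / (7 * k)) ≤ √((4 * q + 4) / 7) := by
    refine Real.sqrt_le_sqrt ?_
    rw [div_le_div_iff₀ (by positivity) (by norm_num)]
    linarith
  have hhit : 0 < AlmostContained.hit (2 * q) 1 := by
    obtain ⟨j, hj⟩ : ∃ j, 2 * q = j + 1 := ⟨2 * q - 1, by omega⟩
    rw [hj]
    exact lt_of_lt_of_le one_pos (AlmostContained.one_le_hit j 0)
  refine le_of_mul_le_mul_left ?_ hhit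
  refine le_trans ?_ (AlmostContained.sub_sqrt_le_hit_mul_EE hk (by omega) hle)
  rw [mul_comm]
  exact (mul_le_mul_of_nonneg_right hsqrt hhit.le).trans (AlmostContained.sqrt_mul_hit_le hq)
end

section
/- For all integers k ≥ 1, d ≥ 0, and L ≥ 0, the random variables P_0(L) and P_d(L) satisfy E[P_d(L) − P_0(L)] ≤ d·√(2L/k) + d. -/
/-- The word with symbols `v` (shifted to `{1, …, k}`), padded with `1`. -/
def padWord {k n : ℕ} (v : Fin n → Fin k) : ℕ → ℕ :=
  fun i => if h : i < n then (v ⟨i, h⟩ : ℕ) + 1 else 1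

/-- The indicator, as a natural number, that the symbol of `w` at position `x` is `c`. -/
def hit (w : ℕ → ℕ) (x c : ℕ) : ℕ := if w x = c then 1 else 0

/-- The position after `t` symbols of `w'` of the `d`-th frog hopping along `w`: it advances when
the symbol it faces is read, or when the previous frog catches up with it. -/
def frog (w w' : ℕ → ℕ) : ℕ → ℕ → ℕ
  | d, 0 => d
  | 0, t + 1 => frog w w' 0 t + hit w (frog w w' 0 t) (w' t)
  | d + 1, t + 1 =>
      max (frog w w' (d + 1) t + hit w (frog w w' (d + 1) t) (w' t)) (frog w w' d (t + 1) + 1)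

@[simp] lemma frog_zero_right (w w' : ℕ → ℕ) (d : ℕ) : frog w w' d 0 = d := by
  cases d <;> simp [frog]

lemma frog_zero_succ (w w' : ℕ → ℕ) (t : ℕ) :
    frog w w' 0 (t + 1) = frog w w' 0 t + hit w (frog w w' 0 t) (w' t) := by
  simp [frog]

lemma frog_succ_succ (w w' : ℕ → ℕ) (d t : ℕ) :
    frog w w' (d + 1) (t + 1) =
      max (frog w w' (d + 1) t + hit w (frog w w' (d + 1) t) (w' t))
        (frog w w' d (t + 1) + 1) := by
  simp [frog]

lemma frog_add_hit_le (w w' : ℕ → ℕ) (d t : ℕ) :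
    frog w w' d t + hit w (frog w w' d t) (w' t) ≤ frog w w' d (t + 1) := by
  cases d with
  | zero => exact (frog_zero_succ w w' t).ge
  | succ d => rw [frog_succ_succ]; exact le_max_left ..

lemma frog_lt_frog_succ (w w' : ℕ → ℕ) (d t : ℕ) : frog w w' d t < frog w w' (d + 1) t := by
  cases t with
  | zero => simp
  | succ t => rw [frog_succ_succ]; omega

lemma frog_congr {w w₁ w₂ : ℕ → ℕ} {t : ℕ} (h : ∀ i < t, w₁ i = w₂ i) (d : ℕ) :
    frog w w₁ d t = frog w w₂ d t := by
  induction t generalizing d with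
  | zero => simp
  | succ t ih =>
    have ih' := ih fun i hi => h i (by omega)
    have ht := h t (by omega)
    induction d with
    | zero => rw [frog_zero_succ, frog_zero_succ, ih', ht]
    | succ d ihd => rw [frog_succ_succ, frog_succ_succ, ih', ht, ihd]

lemma pre_succ (w : ℕ → ℕ) (m : ℕ) : pre w (m + 1) = pre w m ++ [w m] := by
  simp [pre, List.range_succ]

@[simp] lemma length_pre (w : ℕ → ℕ) (m : ℕ) : (pre w m).length = m := by simp [pre]

lemma sublist_append_singleton {α : Type*} {s l : List α} {a : α} (h : s.Sublist (l ++ [a])) :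
    s.Sublist l ∨ ∃ r : List α, s = r ++ [a] ∧ r.Sublist l := by
  obtain ⟨r, q, rfl, hr, hq⟩ := List.sublist_append_iff.1 h
  rcases List.sublist_singleton.1 hq with rfl | rfl
  · exact Or.inl (by simpa using hr)
  · exact Or.inr ⟨r, rfl, hr⟩

lemma le_frog_of_almostIn {w w' : ℕ → ℕ} {d m t : ℕ} (h : AlmostIn d (pre w m) (pre w' t)) :
    m ≤ frog w w' d t := by
  induction t generalizing d m with
  | zero =>
    obtain ⟨s, -, hl, hs⟩ := h
    have := hs.length_le
    simp only [length_pre] at this hl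
    simp only [frog_zero_right]
    omega
  | succ t iht =>
    induction d using Nat.strong_induction_on generalizing m with
    | _ d ihd =>
      obtain ⟨s, hsw, hl, hsw'⟩ := h
      cases m with
      | zero => exact Nat.zero_le _
      | succ m =>
        have hstep := frog_add_hit_le w w' d t
        rw [pre_succ] at hsw
        rcases sublist_append_singleton hsw with hs | ⟨r, rfl, hr⟩
        · have hlen := hs.length_le
          simp only [length_pre] at hlen hl
          cases d with
          | zero => omega
          | succ d =>
            have hm := ihd d d.lt_succ_self ⟨s, hs, by simp only [length_pre]; omega, hsw'⟩
            rw [frog_succ_succ]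
            exact (Nat.succ_le_succ hm).trans (le_max_right _ _)
        · rw [pre_succ] at hsw'
          rcases sublist_append_singleton hsw' with hs | ⟨q, hq, hqw⟩
          · exact (iht ⟨_, by rw [pre_succ]; exact hsw, hl, hs⟩).trans
              ((Nat.le_add_right _ _).trans hstep)
          · obtain ⟨rfl, hc⟩ := List.append_inj' hq rfl
            have hc : w m = w' t := by simpa using hc
            have hm : m ≤ frog w w' d t :=
              iht ⟨r, hr, by simp only [length_pre, List.length_append, List.length_singleton] at hl ⊢
                             omega, hqw⟩
            rcases hm.lt_or_eq with hlt | heq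
            · exact hlt.trans_le ((Nat.le_add_right _ _).trans hstep)
            · rwa [← heq, hit, if_pos hc] at hstep

lemma pre_frog_zero_sublist (w w' : ℕ → ℕ) (t : ℕ) :
    (pre w (frog w w' 0 t)).Sublist (pre w' t) := by
  induction t with
  | zero => simp [pre]
  | succ t ih =>
    rw [frog_zero_succ, pre_succ, hit]
    split_ifs with h
    · rw [pre_succ, h]
      exact ih.append (List.Sublist.refl _)
    · exact ih.trans (List.sublist_append_left _ _)

lemma Pd_le_frog (d L : ℕ) (w w' : ℕ → ℕ) : Pd d L w w' ≤ frog w w' d L :=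
  csSup_le' fun _ hm => le_frog_of_almostIn hm

lemma frog_zero_le_Pd (L : ℕ) (w w' : ℕ → ℕ) : frog w w' 0 L ≤ Pd 0 L w w' :=
  le_csSup ⟨frog w w' 0 L, fun _ hm => le_frog_of_almostIn hm⟩
    ⟨_, List.Sublist.refl _, by simp, pre_frog_zero_sublist w w' L⟩

/-- The number of positions strictly between the `d`-th and `(d + 1)`-st frogs. -/
def gap (w w' : ℕ → ℕ) (d t : ℕ) : ℝ := (frog w w' (d + 1) t : ℝ) - frog w w' d t - 1

lemma gap_succ_sq_le (w w' : ℕ → ℕ) (d t : ℕ) :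
    gap w w' d (t + 1) ^ 2 ≤ gap w w' d t ^ 2
      + 2 * gap w w' d t * (hit w (frog w w' (d + 1) t) (w' t) - hit w (frog w w' d t) (w' t))
      + (hit w (frog w w' (d + 1) t) (w' t) + hit w (frog w w' d t) (w' t)) := by
  set a := hit w (frog w w' (d + 1) t) (w' t) with ha
  set b := hit w (frog w w' d t) (w' t) with hb
  have hab : ((a : ℝ) - b) ^ 2 ≤ a + b := by
    rw [ha, hb]
    unfold hit
    split_ifs <;> norm_num
  suffices gap w w' d (t + 1) ^ 2 ≤ (gap w w' d t + a - b) ^ 2 by linarith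
  have h0 : 0 ≤ gap w w' d (t + 1) := by
    have : ((frog w w' d (t + 1) + 1 : ℕ) : ℝ) ≤ frog w w' (d + 1) (t + 1) :=
      Nat.cast_le.2 (frog_lt_frog_succ w w' d (t + 1))
    push_cast at this
    unfold gap
    linarith
  have hle : ((frog w w' d t + b : ℕ) : ℝ) ≤ frog w w' d (t + 1) :=
    Nat.cast_le.2 (frog_add_hit_le w w' d t)
  have hmax := frog_succ_succ w w' d t
  rcases max_choice (frog w w' (d + 1) t + a) (frog w w' d (t + 1) + 1) with h | h
  · rw [h] at hmax
    refine pow_le_pow_left₀ h0 ?_ 2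
    rw [gap, gap, hmax]
    push_cast at hle ⊢
    linarith
  · rw [h] at hmax
    have : gap w w' d (t + 1) = 0 := by
      rw [gap, hmax]
      push_cast
      ring
    rw [this, zero_pow two_ne_zero]
    exact sq_nonneg _

lemma sum_hit {k : ℕ} {w : ℕ → ℕ} (hw : ∀ i, ∃ c : Fin k, w i = (c : ℕ) + 1) (x : ℕ) :
    ∑ c : Fin k, (hit w x ((c : ℕ) + 1) : ℝ) = 1 := by
  obtain ⟨c₀, hc₀⟩ := hw x
  simp [hit, hc₀, Fin.val_inj]

lemma padWord_snoc_of_lt {k t : ℕ} (v : Fin t → Fin k) (c : Fin k) {i : ℕ} (hi : i < t) :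
    padWord (Fin.snoc (α := fun _ => Fin k) v c) i = padWord v i := by
  simp [padWord, hi, Fin.snoc, Nat.lt_succ_of_lt hi]

lemma padWord_snoc_self {k t : ℕ} (v : Fin t → Fin k) (c : Fin k) :
    padWord (Fin.snoc (α := fun _ => Fin k) v c) t = (c : ℕ) + 1 := by
  simp [padWord, Fin.snoc]

lemma sum_gap_sq_le {k : ℕ} {w : ℕ → ℕ} (hw : ∀ i, ∃ c : Fin k, w i = (c : ℕ) + 1) (d t : ℕ) :
    k * ∑ v : Fin t → Fin k, gap w (padWord v) d t ^ 2 ≤ 2 * t * (k : ℝ) ^ t := by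
  induction t with
  | zero => simp [gap]
  | succ t ih =>
    have key (v : Fin t → Fin k) :
        ∑ c : Fin k, gap w (padWord (Fin.snoc (α := fun _ => Fin k) v c)) d (t + 1) ^ 2 ≤
          k * gap w (padWord v) d t ^ 2 + 2 := by
      calc _ ≤ ∑ c : Fin k, (gap w (padWord v) d t ^ 2
            + 2 * gap w (padWord v) d t * (hit w (frog w (padWord v) (d + 1) t) ((c : ℕ) + 1)
              - hit w (frog w (padWord v) d t) ((c : ℕ) + 1))
            + (hit w (frog w (padWord v) (d + 1) t) ((c : ℕ) + 1)
              + hit w (frog w (padWord v) d t) ((c : ℕ) + 1))) := by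
            refine Finset.sum_le_sum fun c _ => ?_
            have h := gap_succ_sq_le w (padWord (Fin.snoc (α := fun _ => Fin k) v c)) d t
            have hf := frog_congr (w := w) fun i (hi : i < t) => padWord_snoc_of_lt v c hi
            rwa [padWord_snoc_self, gap, gap, hf, hf] at h
        _ = _ := by
            rw [Finset.sum_add_distrib, Finset.sum_add_distrib, Finset.sum_add_distrib,
              ← Finset.mul_sum, Finset.sum_sub_distrib, sum_hit hw, sum_hit hw]
            simp
            norm_num
    have hsum : ∑ v : Fin (t + 1) → Fin k, gap w (padWord v) d (t + 1) ^ 2 ≤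
        k * ∑ v : Fin t → Fin k, gap w (padWord v) d t ^ 2 + 2 * (k : ℝ) ^ t := by
      rw [← (Fin.snocEquiv fun _ => Fin k).sum_comp, Fintype.sum_prod_type_right]
      refine (Finset.sum_le_sum fun v _ => key v).trans (le_of_eq ?_)
      rw [Finset.sum_add_distrib, ← Finset.mul_sum]
      simp [mul_comm]
    calc _ ≤ (k : ℝ) * (2 * t * (k : ℝ) ^ t + 2 * (k : ℝ) ^ t) := by gcongr; linarith
      _ = _ := by push_cast; ring

lemma sum_gap_le {k : ℕ} (hk : 1 ≤ k) {w : ℕ → ℕ} (hw : ∀ i, ∃ c : Fin k, w i = (c : ℕ) + 1)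
    (d t : ℕ) :
    ∑ v : Fin t → Fin k, gap w (padWord v) d t ≤ √(2 * t / k) * (k : ℝ) ^ t := by
  have hk0 : (0 : ℝ) < k := by exact_mod_cast hk
  have hcs := sq_sum_le_card_mul_sum_sq (s := (Finset.univ : Finset (Fin t → Fin k)))
    (f := fun v => gap w (padWord v) d t)
  have hsq : ∑ v : Fin t → Fin k, gap w (padWord v) d t ^ 2 ≤ 2 * t / k * (k : ℝ) ^ t := by
    rw [div_mul_eq_mul_div, le_div_iff₀ hk0, mul_comm]
    exact sum_gap_sq_le hw d t
  refine (abs_le_of_sq_le_sq' ?_ (by positivity)).2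
  rw [mul_pow, Real.sq_sqrt (by positivity)]
  calc _ ≤ _ := hcs
    _ ≤ (k : ℝ) ^ t * (2 * t / k * (k : ℝ) ^ t) := by simpa using by gcongr
    _ = _ := by ring

lemma sum_Pd_sub_le {k : ℕ} (hk : 1 ≤ k) {w : ℕ → ℕ} (hw : ∀ i, ∃ c : Fin k, w i = (c : ℕ) + 1)
    (d L : ℕ) :
    ∑ v : Fin L → Fin k, ((Pd d L w (padWord v) : ℝ) - Pd 0 L w (padWord v)) ≤
      (d * √(2 * L / k) + d) * (k : ℝ) ^ L := by
  have hpt (v : Fin L → Fin k) : (Pd d L w (padWord v) : ℝ) - Pd 0 L w (padWord v) ≤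
      ∑ j ∈ Finset.range d, (gap w (padWord v) j L + 1) := by
    have h1 : (Pd d L w (padWord v) : ℝ) ≤ frog w (padWord v) d L :=
      Nat.cast_le.2 (Pd_le_frog d L w _)
    have h2 : (frog w (padWord v) 0 L : ℝ) ≤ Pd 0 L w (padWord v) :=
      Nat.cast_le.2 (frog_zero_le_Pd L w _)
    have h3 := Finset.sum_range_sub (fun j => (frog w (padWord v) j L : ℝ)) d
    simp only [gap, sub_add_cancel]
    linarith
  calc _ ≤ ∑ v : Fin L → Fin k, ∑ j ∈ Finset.range d, (gap w (padWord v) j L + 1) :=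
        Finset.sum_le_sum fun v _ => hpt v
    _ = ∑ j ∈ Finset.range d, (∑ v : Fin L → Fin k, gap w (padWord v) j L + (k : ℝ) ^ L) := by
        rw [Finset.sum_comm]
        simp [Finset.sum_add_distrib]
    _ ≤ ∑ _j ∈ Finset.range d, (√(2 * L / k) * (k : ℝ) ^ L + (k : ℝ) ^ L) :=
        Finset.sum_le_sum fun j _ => by linarith [sum_gap_le hk hw j L]
    _ = _ := by
        rw [Finset.sum_const, Finset.card_range, nsmul_eq_mul]
        ring

lemma padWord_mem {k n : ℕ} (hk : 1 ≤ k) (u : Fin n → Fin k) (i : ℕ) :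
    ∃ c : Fin k, padWord u i = (c : ℕ) + 1 := by
  by_cases h : i < n
  · exact ⟨u ⟨i, h⟩, by simp [padWord, h]⟩
  · exact ⟨⟨0, hk⟩, by simp [padWord, h]⟩

/-- For all integers `k ≥ 1`, `d ≥ 0` and `L ≥ 0`,
`E[P_d(L) − P_0(L)] ≤ d √(2L/k) + d`.  (Since `P_d(L) ≤ L + d` always, the random variable
`P_d(L) − P_0(L)` depends only on the first `L+d` symbols of `w` and the first `L`
symbols of `w'`, so its expectation is computed by `EE k (L+d) L`.) -/
theorem stmt3 (k d L : ℕ) (hk : 1 ≤ k) :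
    EE k (L + d) L (fun w w' => (Pd d L w w' : ℝ) - (Pd 0 L w w' : ℝ)) ≤
      (d : ℝ) * Real.sqrt (2 * L / k) + d := by
  have hk0 : (0 : ℝ) < k := by exact_mod_cast hk
  rw [EE, div_le_iff₀ (by positivity)]
  refine (Finset.sum_le_sum fun u _ => sum_Pd_sub_le hk (padWord_mem hk u) d L).trans
    (le_of_eq ?_)
  simp
  ring
end

section
/- Let k, n, M, L, H be positive integers, let w be a word of length n over [k], and let w' be a word of length ML over [k], written as a concatenation w' = w'_1 w'_2 ⋯ w'_M of M words of length L each. If LCS(w,w') ≥ n − H, then there exists a vector d⃗ = (d_1,...,d_M) of non-negative integers with d_1 + ⋯ + d_M ≤ H such that w ≺_{d⃗} w'. -/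
/-- Length of a longest common subsequence of two words (words are lists of naturals). -/
noncomputable def LCSlen (w w' : List ℕ) : ℕ :=
  sSup {n | ∃ u : List ℕ, u.Sublist w ∧ u.Sublist w' ∧ u.length = n}

/-- `w` is `d⃗`-almost contained in the concatenation `w'_1 ⋯ w'_M` (the `i`-th block being
`wp i`): there is a decomposition `w = w_1 ⋯ w_M` into possibly empty words such that
`w_i` is `d_i`-almost contained in `w'_i` for every `i`. -/
def VecAlmostIn {M : ℕ} (dv : Fin M → ℕ) (w : List ℕ) (wp : Fin M → List ℕ) : Prop :=
  ∃ parts : Fin M → List ℕ,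
    w = (List.ofFn parts).flatten ∧ ∀ i, AlmostIn (dv i) (parts i) (wp i)

/-- The supremum defining `LCSlen` is attained. -/
theorem exists_sublist_length_eq_LCSlen (w w' : List ℕ) :
    ∃ u : List ℕ, u.Sublist w ∧ u.Sublist w' ∧ u.length = LCSlen w w' := by
  refine Nat.sSup_mem (s := {n | ∃ u : List ℕ, u.Sublist w ∧ u.Sublist w' ∧ u.length = n})
    ⟨0, [], List.nil_sublist _, List.nil_sublist _, rfl⟩ ⟨w.length, ?_⟩
  rintro _ ⟨u, hu, -, rfl⟩
  exact hu.length_le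

/-- A common subsequence `u` of `w` and a nonempty concatenation of blocks yields an almost
containment whose total number of deletions is `w.length - u.length`. -/
theorem exists_vecAlmostIn_of_sublist {M : ℕ} (wp : Fin (M + 1) → List ℕ) {u w : List ℕ}
    (hw : u.Sublist w) (hwp : u.Sublist (List.ofFn wp).flatten) :
    ∃ dv : Fin (M + 1) → ℕ, (∑ i, dv i) + u.length = w.length ∧ VecAlmostIn dv w wp := by
  induction M generalizing u w with
  | zero =>
    refine ⟨fun _ => w.length - u.length, ?_, fun _ => w, by simp, fun i => ⟨u, hw, ?_, ?_⟩⟩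
    · simpa using Nat.sub_add_cancel hw.length_le
    · exact le_add_tsub
    · simpa [Fin.fin_one_eq_zero i] using hwp
  | succ M ih =>
    rw [List.ofFn_succ, List.flatten_cons] at hwp
    obtain ⟨u₁, u₂, rfl, h₁, h₂⟩ := List.sublist_append_iff.mp hwp
    obtain ⟨w₁, w₂, rfl, hw₁, hw₂⟩ := List.append_sublist_iff.mp hw
    obtain ⟨dv, hsum, parts, rfl, hparts⟩ := ih (fun i => wp i.succ) hw₂ h₂
    refine ⟨Fin.cons (w₁.length - u₁.length) dv, ?_, Fin.cons w₁ parts, ?_, ?_⟩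
    · have := hw₁.length_le
      simp only [Fin.sum_univ_succ, Fin.cons_zero, Fin.cons_succ, List.length_append] at hsum ⊢
      omega
    · rw [List.ofFn_succ]
      simp
    · refine Fin.cases ⟨u₁, hw₁, ?_, h₁⟩ hparts
      simp only [Fin.cons_zero]
      omega

/-- Let `k, n, M, L, H` be positive integers, `w` a word of length `n`
over `[k]`, and `w' = w'_1 ⋯ w'_M` a word over `[k]` written as a concatenation of `M`
words of length `L` each.  If `LCS(w, w') ≥ n − H`, then there is a vector
`d⃗ = (d_1, …, d_M)` of non-negative integers with `d_1 + ⋯ + d_M ≤ H` and `w ≺_{d⃗} w'`. -/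
theorem stmt8 (k n M L H : ℕ) (hk : 1 ≤ k) (hn : 1 ≤ n) (hM : 1 ≤ M) (hL : 1 ≤ L)
    (hH : 1 ≤ H) (w : List ℕ) (hwlen : w.length = n) (hw : ∀ s ∈ w, 1 ≤ s ∧ s ≤ k)
    (wp : Fin M → List ℕ) (hwplen : ∀ i, (wp i).length = L)
    (hwp : ∀ i, ∀ s ∈ wp i, 1 ≤ s ∧ s ≤ k)
    (hlcs : n - H ≤ LCSlen w (List.ofFn wp).flatten) :
    ∃ dv : Fin M → ℕ, (∑ i, dv i) ≤ H ∧ VecAlmostIn dv w wp := by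
  obtain ⟨u, hu, hu', hlen⟩ := exists_sublist_length_eq_LCSlen w (List.ofFn wp).flatten
  obtain ⟨M, rfl⟩ := Nat.exists_eq_add_of_le' hM
  obtain ⟨dv, hsum, hdv⟩ := exists_vecAlmostIn_of_sublist wp hu hu'
  exact ⟨dv, by omega, hdv⟩
end

section
/- For all integers d ≥ 1, L ≥ 1 and k ≥ 2, the number |B| of non-trivial expectant partitions among the first L steps satisfies Pr[ |B| ≥ 6d²L/k ] ≤ 4d²L·exp(−L^{1/2}·k^{−3/2}). -/
open scoped Classical in
/-- Probability of an event depending on a pair of independent uniformly random infinite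
words over `[k]`, via the cutoffs `N`, `N'`. -/
noncomputable def PrEE (k N N' : ℕ) (p : (ℕ → ℕ) → (ℕ → ℕ) → Prop) : ℝ :=
  EE k N N' fun w w' => if p w w' then 1 else 0

/-! ### Averages over a block of coordinates -/

/-- The average of `f` over independent uniform choices in `A` of the symbols at positions
`n, …, n + m - 1` of the word `w`. -/
noncomputable def avg (A : Finset ℕ) :
    ℕ → ℕ → ((ℕ → ℕ) → ℝ) → (ℕ → ℕ) → ℝ
  | 0, _, f, w => f w
  | m + 1, n, f, w => (∑ c ∈ A, avg A m (n + 1) f (Function.update w n c)) / A.card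

lemma avg_mono {A : Finset ℕ} (m : ℕ) : ∀ (n : ℕ) {f g : (ℕ → ℕ) → ℝ} {w : ℕ → ℕ},
    (∀ x : ℕ → ℕ, (∀ i < n, x i = w i) → f x ≤ g x) → avg A m n f w ≤ avg A m n g w := by
  induction m with
  | zero => intro n f g w h; exact h w fun _ _ => rfl
  | succ m ih =>
    intro n f g w h
    simp only [avg]
    gcongr with c hc
    refine ih (n + 1) fun x hx => h x fun i hi => ?_
    rw [hx i (by omega), Function.update_of_ne (by omega)]

lemma avg_congr {A : Finset ℕ} (m n : ℕ) {f g : (ℕ → ℕ) → ℝ} {w : ℕ → ℕ}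
    (h : ∀ x : ℕ → ℕ, (∀ i < n, x i = w i) → f x = g x) : avg A m n f w = avg A m n g w :=
  le_antisymm (avg_mono m n fun x hx => (h x hx).le) (avg_mono m n fun x hx => (h x hx).ge)

lemma avg_const {A : Finset ℕ} (hA : A.Nonempty) (m : ℕ) (r : ℝ) :
    ∀ (n : ℕ) (w : ℕ → ℕ), avg A m n (fun _ => r) w = r := by
  induction m with
  | zero => intro n w; rfl
  | succ m ih =>
    intro n w
    have : (A.card : ℝ) ≠ 0 := by exact_mod_cast hA.card_pos.ne'
    simp only [avg, ih, Finset.sum_const, nsmul_eq_mul]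
    field_simp

lemma avg_const_mul {A : Finset ℕ} (m : ℕ) (r : ℝ) (f : (ℕ → ℕ) → ℝ) :
    ∀ (n : ℕ) (w : ℕ → ℕ), avg A m n (fun x => r * f x) w = r * avg A m n f w := by
  induction m with
  | zero => intro n w; rfl
  | succ m ih => intro n w; simp only [avg, ih, ← Finset.mul_sum, mul_div_assoc]

lemma avg_div {A : Finset ℕ} (m : ℕ) (r : ℝ) (f : (ℕ → ℕ) → ℝ) (n : ℕ) (w : ℕ → ℕ) :
    avg A m n (fun x => f x / r) w = avg A m n f w / r := by
  simp only [div_eq_inv_mul, avg_const_mul]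

lemma avg_sum {A : Finset ℕ} {ι : Type*} (s : Finset ι) (m : ℕ) (f : ι → (ℕ → ℕ) → ℝ) :
    ∀ (n : ℕ) (w : ℕ → ℕ),
      avg A m n (fun x => ∑ i ∈ s, f i x) w = ∑ i ∈ s, avg A m n (f i) w := by
  induction m with
  | zero => intro n w; rfl
  | succ m ih =>
    intro n w
    simp only [avg, ih, Finset.sum_div]
    exact Finset.sum_comm

lemma avg_add_fun {A : Finset ℕ} (m : ℕ) (f g : (ℕ → ℕ) → ℝ) :
    ∀ (n : ℕ) (w : ℕ → ℕ),
      avg A m n (fun x => f x + g x) w = avg A m n f w + avg A m n g w := by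
  induction m with
  | zero => intro n w; rfl
  | succ m ih => intro n w; simp only [avg, ih, Finset.sum_add_distrib, add_div]

lemma avg_add {A : Finset ℕ} (b : ℕ) (f : (ℕ → ℕ) → ℝ) (a : ℕ) :
    ∀ (n : ℕ) (w : ℕ → ℕ),
      avg A (a + b) n f w = avg A a n (fun x => avg A b (n + a) f x) w := by
  induction a with
  | zero => intro n w; simp [avg]
  | succ a ih =>
    intro n w
    rw [show a + 1 + b = a + b + 1 by omega]
    simp only [avg, ih]
    rw [show n + 1 + a = n + (a + 1) by omega]

lemma avg_le_const {A : Finset ℕ} (hA : A.Nonempty) (m n : ℕ) {f : (ℕ → ℕ) → ℝ} {w : ℕ → ℕ}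
    {r : ℝ} (h : ∀ x, f x ≤ r) : avg A m n f w ≤ r :=
  (avg_mono m n fun x _ => h x).trans (avg_const hA m r n w).le

lemma sum_words_eq_avg {k : ℕ} (hk : 0 < k) (f : (ℕ → ℕ) → ℝ) (m : ℕ) :
    ∀ (n : ℕ) (w : ℕ → ℕ),
      ∑ u : Fin m → Fin k, f (fun i => if h : n ≤ i ∧ i < n + m then
        (u ⟨i - n, by omega⟩ : ℕ) + 1 else w i) = (k : ℝ) ^ m * avg (Finset.Icc 1 k) m n f w := by
  induction m with
  | zero =>
    intro n w
    have : ∀ i, ¬ (n ≤ i ∧ i < n) := fun i => by omega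
    simp [avg, this]
  | succ m ih =>
    intro n w
    have hk0 : (k : ℝ) ≠ 0 := by exact_mod_cast hk.ne'
    have key : ∀ h : ℕ → ℝ, ∑ c ∈ Finset.Icc 1 k, h c = ∑ c : Fin k, h (c + 1) := by
      intro h
      rw [show Finset.Icc 1 k = Finset.Ico 1 (k + 1) from rfl, Finset.sum_Ico_eq_sum_range,
        Finset.sum_range]
      simp [add_comm]
    simp only [avg, Nat.card_Icc, Nat.add_sub_cancel, key]
    rw [← Equiv.sum_comp (Fin.consEquiv fun _ => Fin k), Fintype.sum_prod_type]
    rw [pow_succ, mul_assoc, mul_div_cancel₀ _ hk0, Finset.mul_sum]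
    refine Finset.sum_congr rfl fun c _ => ?_
    rw [← ih]
    refine Finset.sum_congr rfl fun u _ => ?_
    congr 1
    funext i
    rcases lt_trichotomy i n with h | h | h
    · have h1 : ¬ (n ≤ i ∧ i < n + (m + 1)) := by omega
      have h2 : ¬ (n + 1 ≤ i ∧ i < n + 1 + m) := by omega
      rw [dif_neg h1, dif_neg h2, Function.update_of_ne h.ne]
    · subst h
      simp [Fin.consEquiv]
    · by_cases h3 : i < n + (m + 1)
      · have h1 : n ≤ i ∧ i < n + (m + 1) := by omega
        have h2 : n + 1 ≤ i ∧ i < n + 1 + m := by omega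
        rw [dif_pos h1, dif_pos h2]
        have : (⟨i - n, by omega⟩ : Fin (m + 1)) = Fin.succ ⟨i - (n + 1), by omega⟩ := by
          ext; simp; omega
        rw [this]
        rfl
      · have h1 : ¬ (n ≤ i ∧ i < n + (m + 1)) := by omega
        have h2 : ¬ (n + 1 ≤ i ∧ i < n + 1 + m) := by omega
        rw [dif_neg h1, dif_neg h2, Function.update_of_ne h.ne']

lemma EE_eq_avg {k : ℕ} (hk : 0 < k) (N N' : ℕ) (f : (ℕ → ℕ) → (ℕ → ℕ) → ℝ) :
    EE k N N' f = avg (Finset.Icc 1 k) N 0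
      (fun w => avg (Finset.Icc 1 k) N' 0 (fun v => f w v) fun _ => 1) fun _ => 1 := by
  have h2 : ∀ w, ∑ v : Fin N' → Fin k, f w (fun i => if h : i < N' then
      (v ⟨i, h⟩ : ℕ) + 1 else 1) =
      (k : ℝ) ^ N' * avg (Finset.Icc 1 k) N' 0 (fun v => f w v) fun _ => 1 := by
    intro w
    simpa using sum_words_eq_avg hk (fun v => f w v) N' 0 fun _ => 1
  have h1 := sum_words_eq_avg hk
    (fun w => (k : ℝ) ^ N' * avg (Finset.Icc 1 k) N' 0 (fun v => f w v) fun _ => 1) N 0 fun _ => 1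
  have hk0 : (k : ℝ) ≠ 0 := by exact_mod_cast hk.ne'
  simp only [zero_le, zero_add, true_and, Nat.sub_zero] at h1
  simp only [EE, h2]
  rw [h1, avg_const_mul]
  field_simp

/-! ### The dynamics of the prefix lengths -/

/-- Given the positions `P 0 < P 1 < …`, the `i`-th one moves when the symbol `a` is read: either
`a` is the symbol it waits for, or it is pushed by its predecessor. -/
def Moves (w : ℕ → ℕ) (a : ℕ) (P : ℕ → ℕ) : ℕ → Prop
  | 0 => w (P 0) = a
  | i + 1 => w (P (i + 1)) = a ∨ (P i + 1 = P (i + 1) ∧ Moves w a P i)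

open scoped Classical in
/-- Move the first `J` positions upon reading `a`, leaving the others in place. -/
noncomputable def step (J : ℕ) (w : ℕ → ℕ) (a : ℕ) (P : ℕ → ℕ) (i : ℕ) : ℕ :=
  if i < J ∧ Moves w a P i then P i + 1 else P i

open scoped Classical in
/-- The positions after `t` steps, started from `0, 1, 2, …`. -/
noncomputable def pos (w v : ℕ → ℕ) : ℕ → ℕ → ℕ
  | 0, i => i
  | t + 1, i => if Moves w (v t) (pos w v t) i then pos w v t i + 1 else pos w v t i

lemma Moves.of_hit {w : ℕ → ℕ} {a : ℕ} {P : ℕ → ℕ} {i : ℕ} (h : w (P i) = a) :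
    Moves w a P i := by
  cases i with
  | zero => exact h
  | succ i => exact Or.inl h

lemma moves_congr {w w' : ℕ → ℕ} {a : ℕ} {P P' : ℕ → ℕ} {i : ℕ} (hP : ∀ l ≤ i, P l = P' l)
    (hw : ∀ l ≤ i, w (P l) = w' (P l)) : Moves w a P i ↔ Moves w' a P' i := by
  induction i with
  | zero => simp [Moves, ← hP 0 le_rfl, hw 0 le_rfl]
  | succ i ih =>
    simp only [Moves, ← hP i (by omega), ← hP (i + 1) le_rfl, hw (i + 1) le_rfl,
      ih (fun l hl => hP l (by omega)) fun l hl => hw l (by omega)]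

lemma step_succ_lt {J : ℕ} {w : ℕ → ℕ} {a : ℕ} {P : ℕ → ℕ} {i : ℕ} (h : P i < P (i + 1))
    (hi : i + 1 < J) : step J w a P i < step J w a P (i + 1) := by
  have h3 : Moves w a P (i + 1) ↔
    (w (P (i + 1)) = a ∨ (P i + 1 = P (i + 1) ∧ Moves w a P i)) := Iff.rfl
  simp only [step]
  split_ifs with h1 h2 h2 <;> try omega
  have : ¬ (P i + 1 = P (i + 1)) := fun h4 => h2 ⟨hi, h3.2 (Or.inr ⟨h4, h1.2⟩)⟩
  omega

lemma pos_lt_succ (w v : ℕ → ℕ) (t i : ℕ) : pos w v t i < pos w v t (i + 1) := by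
  induction t generalizing i with
  | zero => simp [pos]
  | succ t ih =>
    have := step_succ_lt (w := w) (a := v t) (ih i) (Nat.lt_succ_self (i + 1))
    grind [step, pos]

lemma almostIn_concat (d : ℕ) (u v : List ℕ) (x a : ℕ) :
    AlmostIn d (u ++ [x]) (v ++ [a]) ↔ AlmostIn d (u ++ [x]) v ∨ (x = a ∧ AlmostIn d u v) ∨
      ∃ e, d = e + 1 ∧ AlmostIn e u (v ++ [a]) := by
  constructor
  · rintro ⟨s, h1, h2, h3⟩
    obtain ⟨s1, s2, rfl, hs1, hs2⟩ := List.sublist_append_iff.1 h1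
    rcases List.sublist_singleton.1 hs2 with rfl | rfl
    · have := hs1.length_le
      simp only [List.append_nil, List.length_append, List.length_singleton] at h2 h3
      refine Or.inr (Or.inr ⟨d - 1, by omega, s1, hs1, by omega, h3⟩)
    · obtain ⟨r1, r2, hr, hr1, hr2⟩ := List.sublist_append_iff.1 h3
      rcases List.sublist_singleton.1 hr2 with rfl | rfl
      · left
        rw [List.append_nil] at hr
        exact ⟨_, h1, h2, hr ▸ hr1⟩
      · obtain ⟨rfl, hx⟩ := List.append_inj' hr rfl
        right; left
        refine ⟨by simpa using hx, s1, hs1, ?_, hr1⟩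
        simp only [List.length_append, List.length_singleton] at h2
        omega
  · rintro (⟨s, h1, h2, h3⟩ | ⟨rfl, s, h1, h2, h3⟩ | ⟨e, rfl, s, h1, h2, h3⟩)
    · exact ⟨s, h1, h2, h3.trans (List.sublist_append_left _ _)⟩
    · refine ⟨s ++ [x], h1.append_right _, ?_, h3.append_right _⟩
      simp only [List.length_append, List.length_singleton]
      omega
    · refine ⟨s, h1.trans (List.sublist_append_left _ _), ?_, h3⟩
      simp only [List.length_append, List.length_singleton]
      omega

lemma almostIn_pre_iff (w v : ℕ → ℕ) (t i m : ℕ) :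
    AlmostIn i (pre w m) (pre v t) ↔ m ≤ pos w v t i := by
  induction t generalizing i m with
  | zero => simp [AlmostIn, pre, pos]
  | succ t iht =>
    induction i generalizing m with
    | zero =>
      cases m with
      | zero => simp [AlmostIn, pre]
      | succ m =>
        rw [pre_succ, pre_succ, almostIn_concat, ← pre_succ, iht, iht]
        have h3 : Moves w (v t) (pos w v t) 0 ↔ w (pos w v t 0) = v t := Iff.rfl
        simp only [pos, h3]
        rcases lt_trichotomy m (pos w v t 0) with h | h | h
        · split_ifs <;> simp <;> omega
        · subst h; split_ifs <;> simp_all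
        · split_ifs <;> simp <;> omega
    | succ i ihi =>
      cases m with
      | zero => simp [AlmostIn, pre]
      | succ m =>
        rw [pre_succ, pre_succ, almostIn_concat, ← pre_succ, ← pre_succ, iht, iht]
        have hlt := pos_lt_succ w v t i
        have h3 : Moves w (v t) (pos w v t) (i + 1) ↔ (w (pos w v t (i + 1)) = v t ∨
          (pos w v t i + 1 = pos w v t (i + 1) ∧ Moves w (v t) (pos w v t) i)) := Iff.rfl
        have h4 : (∃ e, i + 1 = e + 1 ∧ AlmostIn e (pre w m) (pre v (t + 1))) ↔
            m ≤ pos w v (t + 1) i := by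
          rw [← ihi]
          constructor
          · rintro ⟨e, he, h⟩
            obtain rfl : i = e := by omega
            exact h
          · exact fun h => ⟨i, rfl, h⟩
        rw [h4]
        clear h4 iht ihi
        simp only [pos, h3]
        rcases lt_trichotomy m (pos w v t (i + 1)) with h | h | h
        · split_ifs <;> simp <;> omega
        · subst h
          by_cases h5 : Moves w (v t) (pos w v t) i <;>
          by_cases h6 : w (pos w v t (i + 1)) = v t <;>
          by_cases h7 : pos w v t i + 1 = pos w v t (i + 1) <;>
          grind
        · split_ifs <;> simp <;> omega

lemma Pd_eq_pos (w v : ℕ → ℕ) (i t : ℕ) : Pd i t w v = pos w v t i := by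
  simp only [Pd, almostIn_pre_iff]
  exact csSup_Iic

/-! ### The chance that a fresh symbol is met by the first positions -/

/-- The set of symbols that the first `j` positions wait for. -/
def expected (j : ℕ) (w P : ℕ → ℕ) : Finset ℕ :=
  (Finset.range j).image fun i => w (P i)

/-- The probability that, within `T` uniform steps, one of the first `j` positions waits for `c`
before the symbol `c` itself is read. -/
noncomputable def meetProb (A : Finset ℕ) (j : ℕ) (w : ℕ → ℕ) (c : ℕ) : ℕ → (ℕ → ℕ) → ℝ
  | 0, P => if c ∈ expected j w P then 1 else 0
  | T + 1, P => if c ∈ expected j w P then 1 else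
      (∑ a ∈ A.erase c, meetProb A j w c T (step j w a P)) / A.card

lemma mem_expected {j : ℕ} {w P : ℕ → ℕ} {c : ℕ} :
    c ∈ expected j w P ↔ ∃ i < j, w (P i) = c := by
  simp [expected]

lemma card_expected_le (j : ℕ) (w P : ℕ → ℕ) : (expected j w P).card ≤ j :=
  Finset.card_image_le.trans (Finset.card_range j).le

lemma Moves.exists_hit {w : ℕ → ℕ} {a : ℕ} {P : ℕ → ℕ} {i : ℕ} (h : Moves w a P i) :
    ∃ l ≤ i, w (P l) = a := by
  induction i with
  | zero => exact ⟨0, le_rfl, h⟩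
  | succ i ih =>
    rcases h with h | ⟨-, h⟩
    · exact ⟨_, le_rfl, h⟩
    · obtain ⟨l, hl, h⟩ := ih h
      exact ⟨l, by omega, h⟩

lemma step_of_notMem {j : ℕ} {w P : ℕ → ℕ} {a : ℕ} (h : a ∉ expected j w P) :
    step j w a P = P := by
  funext i
  refine if_neg fun ⟨hi, hm⟩ => h ?_
  obtain ⟨l, hl, h⟩ := hm.exists_hit
  exact mem_expected.2 ⟨l, by omega, h⟩

lemma mem_expected_step {j : ℕ} {w P : ℕ → ℕ} {a c : ℕ} (h : c ∈ expected j w P)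
    (hca : c ≠ a) : c ∈ expected j w (step j w a P) := by
  obtain ⟨i, hi, hc⟩ := mem_expected.1 h
  by_cases hm : Moves w a P i
  · cases i with
    | zero => exact absurd (hc.symm.trans hm) hca
    | succ i =>
      rcases hm with hm | ⟨h1, h2⟩
      · exact absurd (hc.symm.trans hm) hca
      · refine mem_expected.2 ⟨i, by omega, ?_⟩
        rw [step, if_pos ⟨by omega, h2⟩, h1, hc]
  · refine mem_expected.2 ⟨i, hi, ?_⟩
    rw [step, if_neg fun h => hm h.2, hc]

lemma meetProb_of_mem {A : Finset ℕ} {j : ℕ} {w P : ℕ → ℕ} {c : ℕ}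
    (h : c ∈ expected j w P) (T : ℕ) : meetProb A j w c T P = 1 := by
  cases T <;> simp [meetProb, h]

lemma meetProb_nonneg (A : Finset ℕ) (j : ℕ) (w : ℕ → ℕ) (c T : ℕ) (P : ℕ → ℕ) :
    0 ≤ meetProb A j w c T P := by
  induction T generalizing P with
  | zero => simp only [meetProb]; split_ifs <;> norm_num
  | succ T ih =>
    simp only [meetProb]
    split_ifs
    · norm_num
    · exact div_nonneg (Finset.sum_nonneg fun a _ => ih _) (Nat.cast_nonneg _)

lemma meetProb_le_one (A : Finset ℕ) (j : ℕ) (w : ℕ → ℕ) (c T : ℕ) (P : ℕ → ℕ) :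
    meetProb A j w c T P ≤ 1 := by
  induction T generalizing P with
  | zero => simp only [meetProb]; split_ifs <;> norm_num
  | succ T ih =>
    simp only [meetProb]
    split_ifs
    · exact le_rfl
    · refine div_le_one_of_le₀ ?_ (Nat.cast_nonneg _)
      refine (Finset.sum_le_sum fun a _ => ih _).trans ?_
      rw [Finset.sum_const, nsmul_eq_mul, mul_one]
      exact_mod_cast Finset.card_le_card (Finset.erase_subset _ _)

lemma sum_sdiff_erase_meetProb_le {A : Finset ℕ} {j : ℕ} {w P : ℕ → ℕ} {T : ℕ} {a : ℕ}
    (h : ∑ c ∈ A, meetProb A j w c T (step j w a P) ≤ 2 * j)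
    (ha : a ∈ A ∩ expected j w P) :
    ∑ c ∈ (A \ expected j w P).erase a, meetProb A j w c T (step j w a P) ≤
      2 * j - ((A ∩ expected j w P).card - 1) := by
  have h1 : (((A ∩ expected j w P).erase a).card : ℝ) =
      ∑ c ∈ (A ∩ expected j w P).erase a, meetProb A j w c T (step j w a P) := by
    rw [← nsmul_one, ← Finset.sum_const]
    refine Finset.sum_congr rfl fun c hc => (meetProb_of_mem (mem_expected_step ?_ ?_) T).symm
    · exact (Finset.mem_inter.1 (Finset.mem_of_mem_erase hc)).2
    · exact Finset.ne_of_mem_erase hc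
  have h2 : ∑ c ∈ (A \ expected j w P).erase a, meetProb A j w c T (step j w a P) ≤
      ∑ c ∈ A \ expected j w P, meetProb A j w c T (step j w a P) :=
    Finset.sum_le_sum_of_subset_of_nonneg (Finset.erase_subset _ _)
      fun _ _ _ => meetProb_nonneg _ _ _ _ _ _
  have h3 : ∑ c ∈ (A ∩ expected j w P).erase a, meetProb A j w c T (step j w a P) ≤
      ∑ c ∈ A ∩ expected j w P, meetProb A j w c T (step j w a P) :=
    Finset.sum_le_sum_of_subset_of_nonneg (Finset.erase_subset _ _)
      fun _ _ _ => meetProb_nonneg _ _ _ _ _ _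
  have h4 := Finset.sum_inter_add_sum_sdiff A (expected j w P)
    fun c => meetProb A j w c T (step j w a P)
  have h5 : (((A ∩ expected j w P).erase a).card : ℝ) = (A ∩ expected j w P).card - 1 := by
    rw [← Finset.card_erase_add_one ha]; push_cast; ring
  linarith

theorem sum_meetProb_le {A : Finset ℕ} {j : ℕ} (hj : j < A.card) (w : ℕ → ℕ) (T : ℕ)
    (P : ℕ → ℕ) : ∑ c ∈ A, meetProb A j w c T P ≤ 2 * j := by
  have hM : ∀ P : ℕ → ℕ, ((A ∩ expected j w P).card : ℝ) ≤ j := fun P => by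
    exact_mod_cast (Finset.card_le_card Finset.inter_subset_right).trans (card_expected_le j w P)
  induction T generalizing P with
  | zero =>
    have : ∑ c ∈ A, meetProb A j w c 0 P = (A ∩ expected j w P).card := by
      simp [meetProb]
    have := hM P
    have : (0 : ℝ) ≤ j := Nat.cast_nonneg j
    linarith
  | succ T ih =>
    set E := expected j w P with hE
    set m : ℝ := ((A ∩ E).card : ℝ) with hm
    set k : ℝ := (A.card : ℝ) with hk
    have hk0 : 0 < k := by rw [hk]; exact_mod_cast (Nat.zero_le j).trans_lt hj
    have hjk : (j : ℝ) + 1 ≤ k := by rw [hk]; exact_mod_cast hj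
    set R := ∑ c ∈ A, meetProb A j w c T P with hR
    have hRle : R ≤ 2 * j := ih P
    have hsplit : ∀ S, ∑ c ∈ A, meetProb A j w c S P =
        m + ∑ c ∈ A \ E, meetProb A j w c S P := fun S => by
      rw [← Finset.sum_inter_add_sum_sdiff A E, hm, ← nsmul_one, ← Finset.sum_const]
      congr 1
      exact Finset.sum_congr rfl fun c hc => meetProb_of_mem (Finset.mem_inter.1 hc).2 S
    have hswap : ∑ c ∈ A \ E, ∑ a ∈ A.erase c, meetProb A j w c T (step j w a P) =
        ∑ a ∈ A, ∑ c ∈ (A \ E).erase a, meetProb A j w c T (step j w a P) := by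
      refine Finset.sum_comm' fun x y => ?_
      simp only [Finset.mem_erase, Finset.mem_sdiff]
      tauto
    have hin : ∑ a ∈ A ∩ E, ∑ c ∈ (A \ E).erase a, meetProb A j w c T (step j w a P) ≤
        m * (2 * j - (m - 1)) := by
      rw [hm, ← nsmul_eq_mul]
      exact Finset.sum_le_card_nsmul _ _ _ fun a ha => sum_sdiff_erase_meetProb_le (ih _) ha
    have hcard : ((A \ E).card : ℝ) = k - m := by
      rw [hk, hm, ← Finset.card_inter_add_card_sdiff A E]; push_cast; ring
    have hout : ∑ a ∈ A \ E, ∑ c ∈ (A \ E).erase a, meetProb A j w c T (step j w a P) =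
        (k - m) * (R - m) - (R - m) := by
      have h1 : R - m = ∑ c ∈ A \ E, meetProb A j w c T P := by rw [hR, hsplit T]; ring
      rw [← hcard, ← nsmul_eq_mul, ← Finset.sum_const, h1, ← Finset.sum_sub_distrib]
      refine Finset.sum_congr rfl fun a ha => ?_
      rw [step_of_notMem (Finset.mem_sdiff.1 ha).2, ← Finset.sum_erase_add _ _ ha]
      ring
    have hsum : ∑ c ∈ A \ E, meetProb A j w c (T + 1) P =
        (∑ c ∈ A \ E, ∑ a ∈ A.erase c, meetProb A j w c T (step j w a P)) / k := by
      rw [Finset.sum_div]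
      refine Finset.sum_congr rfl fun c hc => ?_
      rw [meetProb, if_neg (Finset.mem_sdiff.1 hc).2]
    rw [hsplit, hsum, hswap, ← Finset.sum_inter_add_sum_sdiff A E, hout]
    have hmj := hM P
    have h0 : (k - m - 1) * (R - m) ≤ (k - m - 1) * (2 * j - m) :=
      mul_le_mul_of_nonneg_left (by linarith) (by linarith)
    rw [← le_sub_iff_add_le', div_le_iff₀ hk0]
    nlinarith

/-! ### An exponential supermartingale for the time spent in coincidences -/

/-- The word `w` cut off at position `p`. -/
def cut (p : ℕ) (w : ℕ → ℕ) (i : ℕ) : ℕ :=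
  if i < p then w i else 0

open scoped Classical in
/-- Starting from positions `P` at time `t`, over the next `T` steps: the product of a factor `Λ`
for each step at which the `j`-th position waits for the same symbol as an earlier one, and a
factor `θ` for each move of the `j`-th position. -/
noncomputable def weight (Λ θ : ℝ) (j : ℕ) (w v : ℕ → ℕ) : ℕ → ℕ → (ℕ → ℕ) → ℝ
  | 0, _, _ => 1
  | T + 1, t, P => (if w (P j) ∈ expected j w P then Λ else 1) *
      (if Moves w (v t) P j then θ else 1) *
      weight Λ θ j w v T (t + 1) (step (j + 1) w (v t) P)

lemma lt_last_of_lt_succ {j : ℕ} {P : ℕ → ℕ} (hP : ∀ i < j, P i < P (i + 1)) :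
    ∀ i < j, P i < P j := by
  induction j with
  | zero => intro i hi; omega
  | succ j ih =>
    intro i hi
    rcases Nat.lt_succ_iff_lt_or_eq.1 hi with h | rfl
    · exact (ih (fun i hi => hP i (by omega)) i h).trans (hP j (by omega))
    · exact hP _ hi

lemma cut_update (p : ℕ) (w : ℕ → ℕ) (c : ℕ) : cut p (Function.update w p c) = cut p w := by
  funext i
  by_cases h : i < p
  · simp [cut, h, Function.update_of_ne h.ne]
  · simp [cut, h]

lemma expected_congr {j : ℕ} {w w' P : ℕ → ℕ} (h : ∀ i < j, w (P i) = w' (P i)) :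
    expected j w P = expected j w' P := by
  ext c
  simp only [mem_expected]
  exact exists_congr fun i => and_congr_right fun hi => by rw [h i hi]

lemma step_congr {J : ℕ} {w w' P : ℕ → ℕ} {a : ℕ} (h : ∀ i < J, w (P i) = w' (P i)) :
    step J w a P = step J w' a P := by
  funext i
  have : i < J ∧ Moves w a P i ↔ i < J ∧ Moves w' a P i :=
    and_congr_right fun hi => moves_congr (fun _ _ => rfl) fun l hl => h l (by omega)
  rw [step, step]
  split_ifs <;> tauto

lemma step_succ_of_not_moves {j : ℕ} {w P : ℕ → ℕ} {a : ℕ} (h : ¬ Moves w a P j) :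
    step (j + 1) w a P = step j w a P := by
  funext i
  have : i < j + 1 ∧ Moves w a P i ↔ i < j ∧ Moves w a P i := by
    constructor
    · rintro ⟨h1, h2⟩
      refine ⟨lt_of_le_of_ne (by omega) ?_, h2⟩
      rintro rfl
      exact h h2
    · rintro ⟨h1, h2⟩
      exact ⟨by omega, h2⟩
  rw [step, step]
  split_ifs <;> tauto

theorem avg_weight_le {A : Finset ℕ} {j : ℕ} (hj : j < A.card) {γ Λ θ : ℝ} (hγ : 0 ≤ γ)
    (hΛ0 : 0 ≤ Λ) (hΛ : Λ * (1 + (A.card - 1) * (1 + γ)) ≤ A.card * (1 + γ)) (hθ0 : 0 ≤ θ)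
    (hθ : θ * (1 + γ * (2 * j) / A.card) ≤ 1) (T : ℕ) :
    ∀ (M t : ℕ) (w v P : ℕ → ℕ), T ≤ M + 1 → (∀ i < j, P i < P (i + 1)) → w (P j) ∈ A →
      avg A M (P j + 1) (fun x => avg A T t (fun y => weight Λ θ j x y T t P) v) w ≤
        1 + γ * meetProb A j (cut (P j) w) (w (P j)) T P := by
  have hk0 : (0 : ℝ) < A.card := by exact_mod_cast (Nat.zero_le j).trans_lt hj
  have hA : A.Nonempty := Finset.card_pos.1 ((Nat.zero_le j).trans_lt hj)
  induction T with
  | zero =>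
    intro M t w v P _ _ _
    simp only [avg, weight]
    rw [avg_const hA]
    have := mul_nonneg hγ (meetProb_nonneg A j (cut (P j) w) (w (P j)) 0 P)
    linarith
  | succ T ih =>
    intro M t w v P hM hP hc
    classical
    set p := P j with hp
    set c := w p with hcdef
    set u := cut p w with hu
    have hlt := lt_last_of_lt_succ hP
    have hwu : ∀ i < j, w (P i) = u (P i) := fun i hi => by simp [hu, cut, hp, hlt i hi]
    set μ : ℝ := if c ∈ expected j w P then Λ else 1 with hμ
    set ν : ℕ → ℝ := fun a => if Moves w a P j then θ else 1 with hν
    set X : ℕ → ℝ := fun a => avg A M (p + 1) (fun x => avg A T (t + 1)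
      (fun y => weight Λ θ j x y T (t + 1) (step (j + 1) w a P)) (Function.update v t a)) w
      with hX
    have hexpand : avg A M (p + 1) (fun x => avg A (T + 1) t
        (fun y => weight Λ θ j x y (T + 1) t P) v) w = (∑ a ∈ A, μ * ν a * X a) / A.card := by
      rw [hX]
      simp only [← avg_const_mul]
      rw [← avg_sum, ← avg_div]
      refine avg_congr _ _ fun x hx => ?_
      simp only [avg]
      congr 1
      refine Finset.sum_congr rfl fun a _ => avg_congr _ _ fun y hy => ?_
      have hya : y t = a := by rw [hy t (by omega), Function.update_self]
      have hxw : ∀ i < j + 1, x (P i) = w (P i) := fun i hi => hx _ <| by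
        rcases Nat.lt_succ_iff_lt_or_eq.1 hi with h | rfl
        · have := hlt i h; omega
        · omega
      have hmv : Moves x a P j ↔ Moves w a P j :=
        moves_congr (fun _ _ => rfl) fun l hl => hxw l (by omega)
      rw [weight, hya, step_congr hxw, hxw j (by omega),
        expected_congr fun i hi => hxw i (by omega)]
      simp only [hmv, hμ, hν, ← hp, ← hcdef]
    have hXle : ∀ a, ν a * X a ≤ 1 + if a = c then 0 else
        γ * meetProb A j u c T (step j u a P) := by
      intro a
      have hP' : ∀ i < j, step (j + 1) w a P i < step (j + 1) w a P (i + 1) :=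
        fun i hi => step_succ_lt (hP i hi) (by omega)
      by_cases hm : Moves w a P j
      · have hpj : step (j + 1) w a P j = p + 1 := by simp [step, hm, hp]
        have h1 : X a ≤ 1 + γ * (2 * j) / A.card := by
          rcases M with _ | M
          · obtain rfl : T = 0 := by omega
            have : 0 ≤ γ * (2 * j) / A.card := by positivity
            simpa [hX, avg, weight] using this
          simp only [hX, avg]
          rw [div_le_iff₀ hk0, add_mul, div_mul_cancel₀ _ hk0.ne', one_mul]
          have h2 : ∀ c' ∈ A, avg A M (p + 1 + 1) (fun x => avg A T (t + 1)
              (fun y => weight Λ θ j x y T (t + 1) (step (j + 1) w a P))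
              (Function.update v t a)) (Function.update w (p + 1) c') ≤
              1 + γ * meetProb A j (cut (p + 1) w) c' T (step (j + 1) w a P) := by
            intro c' hc'
            have := ih M (t + 1) (Function.update w (p + 1) c') (Function.update v t a)
              (step (j + 1) w a P) (by omega) hP' (by rw [hpj]; simpa using hc')
            rwa [hpj, cut_update, Function.update_self] at this
          refine (Finset.sum_le_sum h2).trans ?_
          rw [Finset.sum_add_distrib, ← Finset.mul_sum, Finset.sum_const, nsmul_eq_mul, mul_one]
          have := mul_le_mul_of_nonneg_left
            (sum_meetProb_le hj (cut (p + 1) w) T (step (j + 1) w a P)) hγ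
          linarith
        have h3 : ν a * X a ≤ 1 := by
          simp only [hν, if_pos hm]
          exact (mul_le_mul_of_nonneg_left h1 hθ0).trans hθ
        have h4 : (0 : ℝ) ≤ if a = c then 0 else γ * meetProb A j u c T (step j u a P) := by
          split_ifs
          · exact le_rfl
          · exact mul_nonneg hγ (meetProb_nonneg _ _ _ _ _ _)
        linarith
      · have hac : a ≠ c := fun h => hm (Moves.of_hit h.symm)
        have hst : step (j + 1) w a P = step j u a P :=
          (step_succ_of_not_moves hm).trans (step_congr hwu)
        have hpj : step (j + 1) w a P j = p := by simp [step, hm, hp]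
        have := ih M (t + 1) w (Function.update v t a) (step (j + 1) w a P) (by omega) hP'
          (by rwa [hpj])
        rw [hpj] at this
        simp only [hν, if_neg hm, one_mul, if_neg hac, ← hst]
        exact this
    have hexp : expected j w P = expected j u P := expected_congr hwu
    rw [hexpand, div_le_iff₀ hk0]
    have hsum : ∑ a ∈ A, μ * ν a * X a ≤ μ * (A.card + γ * ∑ a ∈ A.erase c,
        meetProb A j u c T (step j u a P)) := by
      simp only [mul_assoc]
      rw [← Finset.mul_sum]
      refine mul_le_mul_of_nonneg_left ?_ (by rw [hμ]; split_ifs <;> linarith)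
      refine (Finset.sum_le_sum fun a _ => hXle a).trans (le_of_eq ?_)
      rw [Finset.sum_add_distrib, Finset.sum_const, nsmul_eq_mul, mul_one,
        ← Finset.add_sum_erase _ _ hc, if_pos rfl, zero_add, Finset.mul_sum]
      congr 1
      exact Finset.sum_congr rfl fun a ha => if_neg (Finset.ne_of_mem_erase ha)
    refine hsum.trans ?_
    by_cases hmem : c ∈ expected j u P
    · rw [meetProb_of_mem hmem, hμ, hexp, if_pos hmem]
      have h5 : ∑ a ∈ A.erase c, meetProb A j u c T (step j u a P) ≤ A.card - 1 := by
        refine (Finset.sum_le_sum fun a _ => meetProb_le_one _ _ _ _ _ _).trans ?_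
        rw [Finset.sum_const, nsmul_eq_mul, mul_one, ← Finset.card_erase_add_one hc]
        push_cast
        linarith
      have h6 : (A.card : ℝ) + γ * ∑ a ∈ A.erase c, meetProb A j u c T (step j u a P) ≤
          1 + (A.card - 1) * (1 + γ) := by
        have := mul_le_mul_of_nonneg_left h5 hγ
        linarith
      have := mul_le_mul_of_nonneg_left h6 hΛ0
      linarith
    · rw [meetProb, if_neg hmem, hμ, hexp, if_neg hmem, add_mul, mul_assoc,
        div_mul_cancel₀ _ hk0.ne']
      linarith

/-! ### The number of moves of a position -/

/-- The positions after `T` further steps, started from `P` at time `t`. -/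
noncomputable def run (J : ℕ) (w v : ℕ → ℕ) : ℕ → ℕ → (ℕ → ℕ) → ℕ → ℕ
  | 0, _, P => P
  | T + 1, t, P => run J w v T (t + 1) (step J w (v t) P)

/-- A potential that grows slowly along the dynamics and controls the `j`-th position. -/
noncomputable def potential (j : ℕ) (P : ℕ → ℕ) : ℝ :=
  ∑ i ∈ Finset.range (j + 1), (1 / 16 : ℝ) ^ i * 2 ^ P i

lemma potential_nonneg (j : ℕ) (P : ℕ → ℕ) : 0 ≤ potential j P :=
  Finset.sum_nonneg fun _ _ => by positivity

open scoped Classical in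
lemma sum_moves_le (A : Finset ℕ) (j : ℕ) (w P : ℕ → ℕ) :
    ∑ i ∈ Finset.range (j + 1), (1 / 16 : ℝ) ^ i *
      ∑ a ∈ A, (if Moves w a P i then (2 : ℝ) ^ P i else 0) ≤ 8 / 7 * potential j P := by
  set W : ℕ → ℝ := fun i => ∑ a ∈ A, (if Moves w a P i then (2 : ℝ) ^ P i else 0) with hW
  have hhit : ∀ i, ∑ a ∈ A, (if w (P i) = a then (2 : ℝ) ^ P i else 0) ≤ 2 ^ P i := fun i => by
    rw [Finset.sum_ite_eq]
    split_ifs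
    · exact le_rfl
    · positivity
  have hW0 : W 0 ≤ 2 ^ P 0 := by
    refine (Finset.sum_le_sum fun a _ => ?_).trans (hhit 0)
    by_cases h : w (P 0) = a
    · rw [if_pos h, if_pos (show Moves w a P 0 from h)]
    · rw [if_neg h, if_neg (show ¬ Moves w a P 0 from h)]
  have hWnn : ∀ i, 0 ≤ W i := fun i => Finset.sum_nonneg fun a _ => by
    split_ifs
    · positivity
    · exact le_rfl
  have hWs : ∀ i, W (i + 1) ≤ 2 ^ P (i + 1) + 2 * W i := by
    intro i
    refine le_trans ?_ (add_le_add_left (hhit (i + 1)) _)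
    rw [hW, Finset.mul_sum, ← Finset.sum_add_distrib]
    refine Finset.sum_le_sum fun a _ => ?_
    have h3 : Moves w a P (i + 1) ↔
      (w (P (i + 1)) = a ∨ (P i + 1 = P (i + 1) ∧ Moves w a P i)) := Iff.rfl
    have hp : (0 : ℝ) < 2 ^ P (i + 1) := by positivity
    have hp' : (0 : ℝ) < 2 ^ P i := by positivity
    by_cases h1 : w (P (i + 1)) = a
    · rw [if_pos (h3.2 (Or.inl h1)), if_pos h1]
      split_ifs <;> linarith
    · by_cases h2 : P i + 1 = P (i + 1) ∧ Moves w a P i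
      · rw [if_pos (h3.2 (Or.inr h2)), if_neg h1, if_pos h2.2, ← h2.1, pow_succ]
        linarith
      · rw [if_neg fun h => (h3.1 h).elim h1 h2]
        split_ifs <;> linarith
  set V : ℕ → ℝ := fun n => ∑ i ∈ Finset.range (n + 1), (1 / 16 : ℝ) ^ i * W i with hV
  have hVnn : ∀ n, 0 ≤ V n := fun n =>
    Finset.sum_nonneg fun i _ => mul_nonneg (by positivity) (hWnn i)
  change V j ≤ _
  have key : V j ≤ potential j P + V j / 8 := by
    cases j with
    | zero =>
      have := hVnn 0
      simp only [hV, potential, zero_add, Finset.sum_range_one, pow_zero, one_mul] at this ⊢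
      linarith
    | succ n =>
      have h1 : V n ≤ V (n + 1) := by
        simp only [hV]
        rw [Finset.sum_range_succ _ (n + 1)]
        have : 0 ≤ (1 / 16 : ℝ) ^ (n + 1) * W (n + 1) := mul_nonneg (by positivity) (hWnn _)
        linarith
      have h2 : V (n + 1) ≤ potential (n + 1) P + V n / 8 := by
        simp only [hV, potential]
        rw [Finset.sum_range_succ' _ (n + 1), Finset.sum_range_succ' _ (n + 1), Finset.sum_div]
        have : ∑ i ∈ Finset.range (n + 1), (1 / 16 : ℝ) ^ (i + 1) * W (i + 1) ≤
            ∑ i ∈ Finset.range (n + 1), ((1 / 16 : ℝ) ^ (i + 1) * 2 ^ P (i + 1) +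
              (1 / 16 : ℝ) ^ i * W i / 8) := by
          refine Finset.sum_le_sum fun i _ => ?_
          have := mul_le_mul_of_nonneg_left (hWs i)
            (show (0 : ℝ) ≤ (1 / 16 : ℝ) ^ (i + 1) by positivity)
          rw [pow_succ] at this ⊢
          linarith
        rw [Finset.sum_add_distrib] at this
        simp only [pow_zero, one_mul]
        linarith
      linarith
  linarith

lemma sum_potential_step_le (A : Finset ℕ) (j : ℕ) (w P : ℕ → ℕ) :
    ∑ a ∈ A, potential j (step (j + 1) w a P) ≤ (A.card + 8 / 7) * potential j P := by
  classical
  have h : ∀ a, potential j (step (j + 1) w a P) = potential j P +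
      ∑ i ∈ Finset.range (j + 1), (1 / 16 : ℝ) ^ i *
        (if Moves w a P i then (2 : ℝ) ^ P i else 0) := by
    intro a
    rw [potential, potential, ← Finset.sum_add_distrib]
    refine Finset.sum_congr rfl fun i hi => ?_
    have hi' := Finset.mem_range.1 hi
    by_cases hm : Moves w a P i
    · rw [step, if_pos ⟨hi', hm⟩, if_pos hm, pow_succ]
      ring
    · rw [step, if_neg fun h => hm h.2, if_neg hm]
      ring
  simp only [h]
  rw [Finset.sum_add_distrib, Finset.sum_const, nsmul_eq_mul, add_mul, Finset.sum_comm]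
  simp only [← Finset.mul_sum]
  linarith [sum_moves_le A j w P]

lemma avg_potential_le {A : Finset ℕ} (hA : A.Nonempty) (j : ℕ) (w : ℕ → ℕ) (T : ℕ) :
    ∀ (t : ℕ) (v P : ℕ → ℕ), avg A T t (fun y => potential j (run (j + 1) w y T t P)) v ≤
      (1 + 8 / 7 / A.card) ^ T * potential j P := by
  have hk0 : (0 : ℝ) < A.card := by exact_mod_cast hA.card_pos
  induction T with
  | zero => intro t v P; simp [avg, run]
  | succ T ih =>
    intro t v P
    rw [avg, div_le_iff₀ hk0]
    have h1 : ∀ a ∈ A, avg A T (t + 1) (fun y => potential j (run (j + 1) w y (T + 1) t P))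
        (Function.update v t a) ≤
        (1 + 8 / 7 / A.card) ^ T * potential j (step (j + 1) w a P) := by
      intro a _
      refine le_trans (avg_mono _ _ fun y hy => ?_) (ih (t + 1) (Function.update v t a) _)
      rw [run, hy t (by omega), Function.update_self]
    refine (Finset.sum_le_sum h1).trans ?_
    rw [← Finset.mul_sum]
    refine (mul_le_mul_of_nonneg_left (sum_potential_step_le A j w P) (by positivity)).trans
      (le_of_eq ?_)
    have h2 : (1 + 8 / 7 / (A.card : ℝ)) * A.card = A.card + 8 / 7 := by field_simp
    rw [← h2]
    ring

/-! ### Identification with the expectant positions -/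

/-- The first `j + 1` positions at time `t`, with the others left at their initial place. -/
noncomputable def front (j : ℕ) (w v : ℕ → ℕ) (t i : ℕ) : ℕ :=
  if i ≤ j then pos w v t i else i

lemma front_zero (j : ℕ) (w v : ℕ → ℕ) : front j w v 0 = id := by
  funext i
  simp [front, pos]

lemma front_of_le {j : ℕ} {w v : ℕ → ℕ} {t i : ℕ} (h : i ≤ j) :
    front j w v t i = pos w v t i := if_pos h

lemma step_front (j : ℕ) (w v : ℕ → ℕ) (t : ℕ) :
    step (j + 1) w (v t) (front j w v t) = front j w v (t + 1) := by
  funext i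
  by_cases h : i ≤ j
  · have hm : Moves w (v t) (front j w v t) i ↔ Moves w (v t) (pos w v t) i :=
      moves_congr (fun l hl => front_of_le (hl.trans h)) fun _ _ => rfl
    rw [front_of_le h, step, front_of_le h, pos]
    by_cases h' : Moves w (v t) (pos w v t) i
    · rw [if_pos ⟨Nat.lt_succ_of_le h, hm.2 h'⟩, if_pos h']
    · rw [if_neg fun h'' => h' (hm.1 h''.2), if_neg h']
  · rw [step, if_neg (by omega), front, front, if_neg h, if_neg h]

lemma run_front (j : ℕ) (w v : ℕ → ℕ) (T : ℕ) :
    ∀ t, run (j + 1) w v T t (front j w v t) = front j w v (t + T) := by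
  induction T with
  | zero => intro t; rfl
  | succ T ih => intro t; rw [run, step_front, ih, Nat.add_right_comm, Nat.add_assoc]

open scoped Classical in
/-- The number of times before `L` at which the `j`-th position waits for the same symbol as an
earlier one. -/
noncomputable def coincidences (j : ℕ) (w v : ℕ → ℕ) (L : ℕ) : ℕ :=
  ((Finset.range L).filter fun t => w (pos w v t j) ∈ expected j w (pos w v t)).card

lemma weight_nonneg {Λ θ : ℝ} (hΛ : 0 ≤ Λ) (hθ : 0 ≤ θ) (j : ℕ) (w v : ℕ → ℕ) (T : ℕ) :
    ∀ (t : ℕ) (P : ℕ → ℕ), 0 ≤ weight Λ θ j w v T t P := by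
  induction T with
  | zero => intro t P; exact zero_le_one
  | succ T ih =>
    intro t P
    rw [weight]
    refine mul_nonneg (mul_nonneg ?_ ?_) (ih _ _) <;> split_ifs <;> first | assumption | norm_num

lemma weight_front (Λ θ : ℝ) (j : ℕ) (w v : ℕ → ℕ) (T : ℕ) :
    ∀ t, weight Λ θ j w v T t (front j w v t) * (Λ ^ coincidences j w v t * θ ^ pos w v t j) =
      Λ ^ coincidences j w v (t + T) * θ ^ pos w v (t + T) j := by
  classical
  induction T with
  | zero => intro t; simp [weight]
  | succ T ih =>
    intro t
    have hm : Moves w (v t) (front j w v t) j ↔ Moves w (v t) (pos w v t) j :=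
      moves_congr (fun l hl => front_of_le hl) fun _ _ => rfl
    have he : expected j w (front j w v t) = expected j w (pos w v t) := by
      ext c
      simp only [mem_expected]
      exact exists_congr fun i => and_congr_right fun hi => by rw [front_of_le hi.le]
    have h1 : (if w (front j w v t j) ∈ expected j w (front j w v t) then Λ else 1) *
        Λ ^ coincidences j w v t = Λ ^ coincidences j w v (t + 1) := by
      rw [front_of_le le_rfl, he, coincidences, coincidences, Finset.range_add_one,
        Finset.filter_insert]
      split_ifs
      · rw [Finset.card_insert_of_notMem (by simp), pow_succ']
      · rw [one_mul]
    have h2 : (if Moves w (v t) (front j w v t) j then θ else 1) * θ ^ pos w v t j =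
        θ ^ pos w v (t + 1) j := by
      by_cases h : Moves w (v t) (pos w v t) j
      · rw [if_pos (hm.2 h), pos, if_pos h, pow_succ']
      · rw [if_neg (mt hm.1 h), pos, if_neg h, one_mul]
    rw [show t + (T + 1) = t + 1 + T by omega, ← ih (t + 1), ← h1, ← h2, weight, step_front]
    ring

lemma le_pos (w v : ℕ → ℕ) (t i : ℕ) : i ≤ pos w v t i := by
  induction i with
  | zero => exact Nat.zero_le _
  | succ i ih => exact ih.trans_lt (pos_lt_succ w v t i)

lemma weight_eq {Λ θ : ℝ} (hθ : θ ≠ 0) (j : ℕ) (w v : ℕ → ℕ) (L : ℕ) :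
    weight Λ θ j w v L 0 id = Λ ^ coincidences j w v L * θ ^ (pos w v L j - j) := by
  have h := weight_front Λ θ j w v L 0
  rw [front_zero, Nat.zero_add, ← Nat.sub_add_cancel (le_pos w v L j), pow_add, ← mul_assoc] at h
  refine mul_right_cancel₀ (pow_ne_zero j hθ) ?_
  simpa [coincidences, pos, mul_assoc] using h

lemma avg_weight_id_le {A : Finset ℕ} {j : ℕ} (hj : j < A.card) {γ Λ θ : ℝ} (hγ : 0 ≤ γ)
    (hΛ0 : 0 ≤ Λ) (hΛ : Λ * (1 + (A.card - 1) * (1 + γ)) ≤ A.card * (1 + γ)) (hθ0 : 0 ≤ θ)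
    (hθ : θ * (1 + γ * (2 * j) / A.card) ≤ 1) {L d : ℕ} (hjd : j ≤ d) (hL : 1 ≤ L)
    (w v : ℕ → ℕ) :
    avg A (L + d) 0 (fun x => avg A L 0 (fun y => weight Λ θ j x y L 0 id) v) w ≤
      1 + γ * (2 * j) / A.card := by
  have hA : A.Nonempty := Finset.card_pos.1 ((Nat.zero_le j).trans_lt hj)
  have hk0 : (0 : ℝ) < A.card := by exact_mod_cast hA.card_pos
  rw [show L + d = j + ((L + d - j - 1) + 1) by omega, avg_add]
  refine avg_le_const hA _ _ fun x => ?_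
  rw [avg, zero_add, div_le_iff₀ hk0, add_mul, div_mul_cancel₀ _ hk0.ne', one_mul]
  have h2 : ∀ c ∈ A, avg A (L + d - j - 1) (j + 1)
      (fun x => avg A L 0 (fun y => weight Λ θ j x y L 0 id) v) (Function.update x j c) ≤
      1 + γ * meetProb A j (cut j x) c L id := by
    intro c hc
    have := avg_weight_le hj hγ hΛ0 hΛ hθ0 hθ L (L + d - j - 1) 0 (Function.update x j c) v id
      (by omega) (fun i _ => Nat.lt_succ_self i) (by simpa using hc)
    simpa only [id, cut_update, Function.update_self] using this
  refine (Finset.sum_le_sum h2).trans ?_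
  rw [Finset.sum_add_distrib, ← Finset.mul_sum, Finset.sum_const, nsmul_eq_mul, mul_one]
  have := mul_le_mul_of_nonneg_left (sum_meetProb_le hj (cut j x) L id) hγ
  linarith

/-! ### The tail bound -/

lemma card_nontrivial_le (d L : ℕ) (w v : ℕ → ℕ)
    [DecidablePred fun l => ∃ i ≤ d, ∃ j ≤ d, i ≠ j ∧ w (Pd i l w v) = w (Pd j l w v)] :
    ((Finset.range L).filter fun l =>
      ∃ i ≤ d, ∃ j ≤ d, i ≠ j ∧ w (Pd i l w v) = w (Pd j l w v)).card ≤
      ∑ j ∈ Finset.Icc 1 d, coincidences j w v L := by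
  classical
  refine le_trans (Finset.card_le_card ?_) Finset.card_biUnion_le
  intro l hl
  obtain ⟨hl, i, hi, j, hj, hij, h⟩ := Finset.mem_filter.1 hl
  simp only [Pd_eq_pos] at h
  simp only [Finset.mem_biUnion, Finset.mem_filter, Finset.mem_Icc, mem_expected]
  rcases lt_or_gt_of_ne hij with h' | h'
  · exact ⟨j, by omega, hl, i, h', h⟩
  · exact ⟨i, by omega, hl, j, h', h.symm⟩

lemma one_le_weight_add_potential {j k L : ℕ} (hj : 1 ≤ j) (hk : 0 < k) (w v : ℕ → ℕ)
    (h : 6 * (j : ℝ) * L / k ≤ coincidences j w v L) :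
    1 ≤ Real.exp (-(L / (5 * k ^ 2))) *
        weight (Real.exp (1 / (5 * k))) (Real.exp (-(j / (2 * k)))) j w v L 0 id +
      8 ^ j * Real.exp (-(2 * Real.log 2 * (L / k))) *
        potential j (run (j + 1) w v L 0 id) := by
  have hk' : (0 : ℝ) < k := by exact_mod_cast hk
  have hj' : (1 : ℝ) ≤ j := by exact_mod_cast hj
  have hw0 := weight_nonneg (Real.exp_nonneg (1 / (5 * (k : ℝ))))
    (Real.exp_nonneg (-((j : ℝ) / (2 * k)))) j w v L 0 id
  have hp0 := potential_nonneg j (run (j + 1) w v L 0 id)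
  set n := pos w v L j - j with hn
  rcases le_total (n : ℝ) (2 * (L / k)) with hnl | hnl
  · refine le_trans ?_ (le_add_of_nonneg_right (by positivity))
    rw [weight_eq (Real.exp_ne_zero _), ← Real.exp_nat_mul, ← Real.exp_nat_mul, ← Real.exp_add,
      ← Real.exp_add, ← hn]
    refine Real.one_le_exp ?_
    have h1 := mul_le_mul_of_nonneg_right h (show (0 : ℝ) ≤ 1 / (5 * k) by positivity)
    have h2 := mul_le_mul_of_nonneg_right hnl (show (0 : ℝ) ≤ j / (2 * k) by positivity)
    have h3 : 6 * (j : ℝ) * L / k * (1 / (5 * k)) - 2 * (L / k) * (j / (2 * k)) =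
        j * (L / (5 * k ^ 2)) := by
      field_simp
      ring
    have h4 := mul_le_mul_of_nonneg_right hj' (show (0 : ℝ) ≤ L / (5 * k ^ 2) by positivity)
    linarith
  · refine le_trans ?_ (le_add_of_nonneg_left (by positivity))
    have h1 : (1 / 8 : ℝ) ^ j * 2 ^ n ≤ potential j (run (j + 1) w v L 0 id) := by
      rw [← front_zero j w v, run_front, zero_add, potential]
      refine le_trans (le_of_eq ?_) (Finset.single_le_sum
        (f := fun i => (1 / 16 : ℝ) ^ i * 2 ^ front j w v L i) (fun _ _ => by positivity)
        (Finset.self_mem_range_succ j))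
      rw [front_of_le le_rfl, ← Nat.sub_add_cancel (le_pos w v L j), pow_add, ← hn,
        show (1 / 8 : ℝ) = 1 / 16 * 2 by norm_num, mul_pow]
      ring
    have h2 : Real.exp (2 * Real.log 2 * (L / k)) ≤ 2 ^ n := by
      rw [← Real.rpow_natCast, Real.rpow_def_of_pos two_pos]
      refine Real.exp_le_exp.2 ?_
      have := mul_le_mul_of_nonneg_left hnl (Real.log_nonneg one_le_two)
      linarith
    calc (1 : ℝ) = 8 ^ j * Real.exp (-(2 * Real.log 2 * (L / k))) *
          ((1 / 8) ^ j * Real.exp (2 * Real.log 2 * (L / k))) := by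
          rw [mul_mul_mul_comm, ← mul_pow, ← Real.exp_add, neg_add_cancel, Real.exp_zero]
          norm_num
      _ ≤ _ := by
          refine mul_le_mul_of_nonneg_left (le_trans ?_ h1) (by positivity)
          exact mul_le_mul_of_nonneg_left h2 (by positivity)

lemma potential_id_le (j : ℕ) : potential j id ≤ 8 / 7 := by
  have : ∀ i : ℕ, (1 / 16 : ℝ) ^ i * 2 ^ id i = (1 / 8) ^ i := fun i => by
    rw [id, ← mul_pow]
    norm_num
  simp only [potential, this]
  rw [geom_sum_eq (by norm_num), div_le_iff_of_neg (by norm_num)]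
  have : (0 : ℝ) ≤ (1 / 8) ^ (j + 1) := by positivity
  linarith

lemma avg_potential_id_le {A : Finset ℕ} (hA : A.Nonempty) (j N L : ℕ) (w v : ℕ → ℕ) :
    avg A N 0 (fun x => avg A L 0 (fun y => potential j (run (j + 1) x y L 0 id)) v) w ≤
      8 / 7 * Real.exp (8 / 7 * (L / A.card)) := by
  refine avg_le_const hA _ _ fun x => (avg_potential_le hA j x L 0 v id).trans ?_
  rw [mul_comm]
  refine mul_le_mul (potential_id_le j) ?_ (by positivity) (by norm_num)
  calc (1 + 8 / 7 / (A.card : ℝ)) ^ L ≤ Real.exp (8 / 7 / A.card) ^ L := by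
        gcongr
        linarith [Real.add_one_le_exp (8 / 7 / (A.card : ℝ))]
    _ = _ := by
        rw [← Real.exp_nat_mul]
        congr 1
        ring

lemma PrEE_mono {k N N' : ℕ} (hk : 0 < k) {p : (ℕ → ℕ) → (ℕ → ℕ) → Prop}
    {f : (ℕ → ℕ) → (ℕ → ℕ) → ℝ} (h0 : ∀ w v, 0 ≤ f w v) (h1 : ∀ w v, p w v → 1 ≤ f w v) :
    PrEE k N N' p ≤ avg (Finset.Icc 1 k) N 0
      (fun w => avg (Finset.Icc 1 k) N' 0 (fun v => f w v) fun _ => 1) fun _ => 1 := by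
  rw [PrEE, EE_eq_avg hk]
  refine avg_mono _ _ fun w _ => avg_mono _ _ fun v _ => ?_
  split_ifs with h
  · exact h1 w v h
  · exact h0 w v

lemma PrEE_coincidences_le {d L k : ℕ} (hL : 1 ≤ L) (hd : 1 ≤ d) (hdk : 2 * d ≤ k)
    {p : (ℕ → ℕ) → (ℕ → ℕ) → Prop}
    (hp : ∀ w v, p w v → ∃ j ∈ Finset.Icc 1 d, 6 * (j : ℝ) * L / k ≤ coincidences j w v L) :
    PrEE k (L + d) L p ≤ d * (3 / 2 * Real.exp (-(L / (5 * k ^ 2))) +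
      8 / 7 * (8 ^ d * Real.exp ((8 / 7 - 2 * Real.log 2) * (L / k)))) := by
  have hk : 0 < k := by omega
  have hk' : (0 : ℝ) < k := by exact_mod_cast hk
  set a : ℝ := Real.exp (-(L / (5 * k ^ 2))) with ha
  set b : ℝ := 8 ^ d * Real.exp (-(2 * Real.log 2 * (L / k))) with hb
  set g : ℕ → (ℕ → ℕ) → (ℕ → ℕ) → ℝ := fun j w v =>
    a * weight (Real.exp (1 / (5 * k))) (Real.exp (-(j / (2 * k)))) j w v L 0 id +
      b * potential j (run (j + 1) w v L 0 id) with hg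
  have ha0 : 0 ≤ a := Real.exp_nonneg _
  have hb0 : 0 ≤ b := by positivity
  have hg0 : ∀ j w v, 0 ≤ g j w v := fun j w v =>
    add_nonneg (mul_nonneg ha0 (weight_nonneg (Real.exp_nonneg _) (Real.exp_nonneg _) ..))
      (mul_nonneg hb0 (potential_nonneg ..))
  have h1 : ∀ w v, p w v → 1 ≤ ∑ j ∈ Finset.Icc 1 d, g j w v := by
    intro w v h
    obtain ⟨j, hj, hjc⟩ := hp w v h
    obtain ⟨hj1, hj2⟩ := Finset.mem_Icc.1 hj
    refine le_trans ?_ (Finset.single_le_sum (f := fun j => g j w v) (fun j _ => hg0 j w v) hj)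
    refine (one_le_weight_add_potential hj1 hk w v hjc).trans (add_le_add_right ?_ _)
    refine mul_le_mul_of_nonneg_right ?_ (potential_nonneg ..)
    rw [hb]
    gcongr
    norm_num
  refine (PrEE_mono hk (fun w v => Finset.sum_nonneg fun j _ => hg0 j w v) h1).trans ?_
  simp only [avg_sum]
  have hA : (Finset.Icc 1 k).Nonempty := ⟨1, by simp; omega⟩
  have hcard : (Finset.Icc 1 k).card = k := by simp
  refine (Finset.sum_le_card_nsmul _ _ _ fun j hj => ?_).trans_eq
    (by rw [Nat.card_Icc, Nat.add_sub_cancel, nsmul_eq_mul])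
  obtain ⟨hj1, hj2⟩ := Finset.mem_Icc.1 hj
  have hjk : 2 * (j : ℝ) ≤ k := by exact_mod_cast (by omega : 2 * j ≤ k)
  simp only [hg, avg_add_fun, avg_const_mul]
  have hweight := avg_weight_id_le (A := Finset.Icc 1 k) (j := j) (γ := 1 / 4)
    (Λ := Real.exp (1 / (5 * k))) (θ := Real.exp (-(j / (2 * k)))) (d := d) (L := L)
    (by rw [hcard]; omega) (by norm_num) (Real.exp_nonneg _)
    (by
      rw [hcard]
      have h2 := Real.add_one_le_exp (-(1 / (5 * (k : ℝ))))
      have h3 := mul_le_mul_of_nonneg_left h2 (Real.exp_nonneg (1 / (5 * (k : ℝ))))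
      rw [← Real.exp_add, add_neg_cancel, Real.exp_zero] at h3
      have h4 := mul_le_mul_of_nonneg_right h3 (show (0 : ℝ) ≤ 5 / 4 * k by positivity)
      have h5 : Real.exp (1 / (5 * (k : ℝ))) * (-(1 / (5 * k)) + 1) * (5 / 4 * k) =
          Real.exp (1 / (5 * k)) * (1 + (k - 1) * (1 + 1 / 4)) := by
        field_simp
        ring
      linarith)
    (Real.exp_nonneg _)
    (by
      rw [hcard]
      have h2 : 1 + 1 / 4 * (2 * (j : ℝ)) / k ≤ Real.exp (j / (2 * k)) := by
        refine le_trans (le_of_eq ?_) (Real.add_one_le_exp _)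
        field_simp
        ring
      refine (mul_le_mul_of_nonneg_left h2 (Real.exp_nonneg _)).trans_eq ?_
      rw [← Real.exp_add, neg_add_cancel, Real.exp_zero])
    hj2 hL (fun _ => 1) (fun _ => 1)
  have hpot := avg_potential_id_le hA j (L + d) L (fun _ => 1) (fun _ => 1)
  rw [hcard] at hweight hpot
  have hq : 1 / 4 * (2 * (j : ℝ)) / k ≤ 1 / 2 := by
    rw [div_le_iff₀ hk']
    linarith
  refine (add_le_add (mul_le_mul_of_nonneg_left (hweight.trans
    (by linarith : _ ≤ (3 / 2 : ℝ))) ha0) (mul_le_mul_of_nonneg_left hpot hb0)).trans_eq ?_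
  rw [mul_comm a, hb, sub_mul, sub_eq_neg_add, Real.exp_add]
  ring

lemma exists_coincidences_of_le {d L k : ℕ} (hd : 1 ≤ d) {w v : ℕ → ℕ}
    (h : 6 * (d : ℝ) ^ 2 * L / k ≤ ∑ j ∈ Finset.Icc 1 d, (coincidences j w v L : ℝ)) :
    ∃ j ∈ Finset.Icc 1 d, 6 * (j : ℝ) * L / k ≤ coincidences j w v L := by
  have h1 : ∑ j ∈ Finset.Icc 1 d, 6 * (d : ℝ) * L / k ≤
      ∑ j ∈ Finset.Icc 1 d, (coincidences j w v L : ℝ) := by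
    refine le_trans (le_of_eq ?_) h
    rw [Finset.sum_const, Nat.card_Icc, Nat.add_sub_cancel, nsmul_eq_mul]
    ring
  obtain ⟨j, hj, hjc⟩ := Finset.exists_le_of_sum_le ⟨1, by simpa using hd⟩ h1
  refine ⟨j, hj, le_trans ?_ hjc⟩
  have : (j : ℝ) ≤ d := by exact_mod_cast (Finset.mem_Icc.1 hj).2
  gcongr

lemma tail_estimate {d k : ℕ} {y : ℝ} (hd : 1 ≤ d) (hdk : 6 * d ^ 2 ≤ k) (hy : 1 ≤ y) :
    3 / 2 * Real.exp (-(k * y ^ 2 / 5)) +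
      8 / 7 * (8 ^ d * Real.exp ((8 / 7 - 2 * Real.log 2) * (k ^ 2 * y ^ 2))) ≤
      4 * Real.exp (-y) := by
  have hd' : (1 : ℝ) ≤ d := by exact_mod_cast hd
  have hdk' : 6 * (d : ℝ) ^ 2 ≤ k := by exact_mod_cast hdk
  have hk6 : (6 : ℝ) ≤ k := by nlinarith
  have hlog1 := Real.log_two_gt_d9
  have hlog2 := Real.log_two_lt_d9
  have hyy : y ≤ y ^ 2 := by nlinarith
  have hkk : 6 * (k : ℝ) ≤ k ^ 2 := by nlinarith
  have hky : (k : ℝ) ^ 2 ≤ k ^ 2 * y ^ 2 := by nlinarith [sq_nonneg (k : ℝ)]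
  have hky' : 36 * y ^ 2 ≤ k ^ 2 * y ^ 2 :=
    mul_le_mul_of_nonneg_right (by nlinarith) (sq_nonneg y)
  have h1 : Real.exp (-(k * y ^ 2 / 5)) ≤ Real.exp (-y) := by
    refine Real.exp_le_exp.2 ?_
    have := mul_le_mul_of_nonneg_right hk6 (sq_nonneg y)
    linarith
  have h2 : 8 ^ d * Real.exp ((8 / 7 - 2 * Real.log 2) * (k ^ 2 * y ^ 2)) ≤ Real.exp (-y) := by
    have h8 : (8 : ℝ) ^ d = Real.exp (d * (3 * Real.log 2)) := by
      rw [Real.exp_nat_mul, show 3 * Real.log 2 = Real.log (2 ^ 3) by rw [Real.log_pow]; norm_num,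
        Real.exp_log (by norm_num)]
      norm_num
    rw [h8, ← Real.exp_add]
    refine Real.exp_le_exp.2 ?_
    have hdd : (d : ℝ) ≤ k ^ 2 * y ^ 2 / 36 := by nlinarith
    have h3 : (d : ℝ) * (3 * Real.log 2) ≤ k ^ 2 * y ^ 2 / 36 * 2.1 := by
      refine mul_le_mul hdd (by linarith) (by linarith) (by positivity)
    have h4 : (8 / 7 - 2 * Real.log 2) * (k ^ 2 * y ^ 2) ≤ -0.24 * (k ^ 2 * y ^ 2) := by
      refine mul_le_mul_of_nonneg_right (by norm_num at hlog1 ⊢; linarith) (by positivity)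
    linarith
  linarith [Real.exp_pos (-y)]
open scoped Classical in
/-- For all integers `d ≥ 1`, `L ≥ 1` and `k ≥ 2`, the number `|B|` of
non-trivial expectant partitions among the first `L` steps satisfies
`Pr[|B| ≥ 6d²L/k] ≤ 4d²L·exp(−L^{1/2} k^{−3/2})`.  Here the expectant partition `𝒜[ℓ]` is
non-trivial exactly when `w[P_i(ℓ)] = w[P_j(ℓ)]` for some `i ≠ j` in `{0, …, d}`; since
`P_i(ℓ) ≤ ℓ + i ≤ L − 1 + d` for `ℓ < L`, the event depends only on the first `L + d`
symbols of `w` and the first `L` symbols of `w'`. -/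
theorem stmt10 (d L k : ℕ) (hd : 1 ≤ d) (hL : 1 ≤ L) (hk : 2 ≤ k) :
    PrEE k (L + d) L (fun w w' =>
        6 * (d : ℝ) ^ 2 * L / k ≤
          (((Finset.range L).filter fun ℓ =>
              ∃ i ≤ d, ∃ j ≤ d, i ≠ j ∧ w (Pd i ℓ w w') = w (Pd j ℓ w w')).card : ℝ)) ≤
      4 * (d : ℝ) ^ 2 * L * Real.exp (-((L : ℝ) ^ ((1 : ℝ) / 2) * (k : ℝ) ^ (-(3 : ℝ) / 2))) := by
  have hk0 : 0 < k := by omega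
  have hk' : (0 : ℝ) < k := by exact_mod_cast hk0
  have hd' : (1 : ℝ) ≤ d := by exact_mod_cast hd
  have hL' : (1 : ℝ) ≤ L := by exact_mod_cast hL
  have hA : (Finset.Icc 1 k).Nonempty := ⟨1, by simp; omega⟩
  set y : ℝ := (L : ℝ) ^ ((1 : ℝ) / 2) * (k : ℝ) ^ (-(3 : ℝ) / 2) with hy
  rcases lt_or_ge k (6 * d ^ 2) with hkd | hkd
  · refine (PrEE_mono hk0 (f := fun _ _ => 0) (fun _ _ => le_rfl) fun w v h => ?_).trans ?_
    · refine absurd h (not_le.2 ?_)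
      refine lt_of_le_of_lt (Nat.cast_le.2 (Finset.card_filter_le _ _)) ?_
      rw [Finset.card_range, lt_div_iff₀ hk', mul_comm]
      refine mul_lt_mul_of_pos_right ?_ (by linarith)
      exact_mod_cast hkd
    · simp only [avg_const hA]
      positivity
  have hdL : (1 : ℝ) ≤ d ^ 2 * L := one_le_mul_of_one_le_of_one_le (one_le_pow₀ hd') hL'
  rcases le_or_gt y 1 with hy1 | hy1
  · refine (PrEE_mono hk0 (f := fun _ _ => 1) (fun _ _ => zero_le_one) fun _ _ _ => le_rfl).trans ?_
    simp only [avg_const hA]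
    have h1 : Real.exp (-1) ≤ Real.exp (-y) := Real.exp_le_exp.2 (by linarith)
    have h2 := Real.exp_neg_one_gt_d9
    nlinarith
  have hy2 : y ^ 2 = L / k ^ 3 := by
    rw [hy, mul_pow, ← Real.rpow_mul_natCast (by positivity),
      ← Real.rpow_mul_natCast (by positivity), div_eq_mul_inv (L : ℝ), ← Real.rpow_natCast (k : ℝ) 3,
      ← Real.rpow_neg hk'.le]
    norm_num
  refine (PrEE_coincidences_le hL hd (by nlinarith) fun w v h =>
    exists_coincidences_of_le hd (h.trans (by exact_mod_cast card_nontrivial_le d L w v))).trans ?_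
  have h1 : (L : ℝ) / (5 * k ^ 2) = k * y ^ 2 / 5 := by
    rw [hy2]
    field_simp
  have h2 : (L : ℝ) / k = k ^ 2 * y ^ 2 := by
    rw [hy2]
    field_simp
  rw [h1, h2]
  have hdd : (d : ℝ) ≤ d ^ 2 * L := by nlinarith
  calc _ ≤ (d : ℝ) * (4 * Real.exp (-y)) := by
        gcongr
        exact tail_estimate hd hkd hy1.le
    _ ≤ d ^ 2 * L * (4 * Real.exp (-y)) := by gcongr
    _ = _ := by ring
end
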